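/- (Coalgebraic Bisimulation Invariance) Let Λ be an expressively complete set of monotone predicate liftings for a set functor T. If T admits an adequate uniform construction, then μML_Λ ≡ MSO_Λ/≃: every formula of μML_Λ is equivalent over pointed T-models to a bisimulation-invariant formula of MSO_Λ, and conversely every bisimulation-invariant formula of MSO_Λ is equivalent over pointed T-models to a formula of μML_Λ. In particular, taking Λ to be the set of all monotone predicate liftings for T: if T admits an adequate uniform construction, then μML_T ≡ MSO_T/≃. -/

import Mathlib

open scoped Classical

/-- A set functor: an endofunctor on the category of sets (types in `Type`). -/
structure SetFunctor where
  obj : Type → Type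
  map : {X Y : Type} → (X → Y) → obj X → obj Y
  map_id : ∀ {X : Type} (x : obj X), map id x = x
  map_comp : ∀ {X Y Z : Type} (f : X → Y) (g : Y → Z) (x : obj X),
    map (g ∘ f) x = map g (map f x)

/-- An `n`-place predicate lifting for `T`: a natural transformation `𝒬(-)ⁿ → 𝒬 ∘ T`. -/
structure PredLifting (T : SetFunctor) (n : ℕ) where
  app : (X : Type) → (Fin n → Set X) → Set (T.obj X)
  natural : ∀ {X Y : Type} (f : X → Y) (V : Fin n → Set Y),
    app X (fun i => f ⁻¹' V i) = T.map f ⁻¹' app Y V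

/-- Monotonicity of a predicate lifting. -/
def PredLifting.Mono {T : SetFunctor} {n : ℕ} (l : PredLifting T n) : Prop :=
  ∀ (X : Type) (V V' : Fin n → Set X), (∀ i, V i ⊆ V' i) → l.app X V ⊆ l.app X V'

/-- A set `Λ` of monotone predicate liftings for `T`, presented as an indexed family. -/
structure LiftingFamily (T : SetFunctor) where
  ι : Type
  ar : ι → ℕ
  lf : (i : ι) → PredLifting T (ar i)
  mono : ∀ i, (lf i).Mono

/-- A generalized predicate lifting over a set `A` of variables. -/
structure GenLifting (T : SetFunctor) (A : Type) where
  app : (X : Type) → (A → Set X) → Set (T.obj X)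

/-- Monotonicity for generalized predicate liftings. -/
def GenLifting.Mono {T : SetFunctor} {A : Type} (φ : GenLifting T A) : Prop :=
  ∀ (X : Type) (V V' : A → Set X), (∀ a : A, V a ⊆ V' a) → φ.app X V ⊆ φ.app X V'

/-- Naturality for generalized predicate liftings. -/
def GenLifting.Natural {T : SetFunctor} {A : Type} (φ : GenLifting T A) : Prop :=
  ∀ (X Y : Type) (f : X → Y) (V : A → Set Y),
    φ.app X (fun a => f ⁻¹' V a) = T.map f ⁻¹' φ.app Y V

/-- Updating a valuation at one variable. -/
noncomputable def updW {W X : Type} (V : W → Set X) (w : W) (Z : Set X) : W → Set X :=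
  fun w' => if w' = w then Z else V w'

/-- Formulas of the one-step second-order language over variables `W`. -/
inductive SOForm {T : SetFunctor} (F : LiftingFamily T) (W : Type) : Type
  | subset (a b : W)
  | lift (i : F.ι) (v : Fin (F.ar i) → W)
  | neg (φ : SOForm F W)
  | or (φ ψ : SOForm F W)
  | ex (w : W) (φ : SOForm F W)

/-- One-step satisfaction of second-order one-step formulas. -/
def SOForm.sat {T : SetFunctor} {F : LiftingFamily T} {W : Type} (X : Type) (α : T.obj X) :
    SOForm F W → (W → Set X) → Prop
  | .subset a b, V => V a ⊆ V b
  | .lift i v, V => α ∈ (F.lf i).app X (fun k => V (v k))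
  | .neg φ, V => ¬ φ.sat X α V
  | .or φ ψ, V => φ.sat X α V ∨ ψ.sat X α V
  | .ex w φ, V => ∃ Z : Set X, φ.sat X α (updW V w Z)

/-- Free variables of a one-step second-order formula. -/
def SOForm.fv {T : SetFunctor} {F : LiftingFamily T} {W : Type} : SOForm F W → Set W
  | .subset a b => {a, b}
  | .lift _ v => Set.range v
  | .neg φ => φ.fv
  | .or φ ψ => φ.fv ∪ ψ.fv
  | .ex w φ => φ.fv \ {w}

/-- Quantifier depth of a one-step second-order formula. -/
def SOForm.qd {T : SetFunctor} {F : LiftingFamily T} {W : Type} : SOForm F W → ℕ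
  | .subset _ _ => 0
  | .lift _ _ => 0
  | .neg φ => φ.qd
  | .or φ ψ => max φ.qd ψ.qd
  | .ex _ φ => φ.qd + 1

/-- A one-step second-order sentence over `A`: a formula over `A ⊕ ℕ` all of whose
free variables come from `A`. -/
def IsSentence {T : SetFunctor} {F : LiftingFamily T} {A : Type}
    (φ : SOForm F (A ⊕ ℕ)) : Prop :=
  ∀ w ∈ φ.fv, ∃ a : A, w = Sum.inl a

/-- Satisfaction of a sentence over `A` at a one-step model `(X, α, V)`. -/
def SOForm.sat0 {T : SetFunctor} {F : LiftingFamily T} {A : Type} (X : Type) (α : T.obj X)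
    (φ : SOForm F (A ⊕ ℕ)) (V : A → Set X) : Prop :=
  φ.sat X α (Sum.elim V (fun _ => (∅ : Set X)))

/-- A sentence is monotone if its induced generalized predicate lifting is monotone. -/
def MonotoneSent {T : SetFunctor} {F : LiftingFamily T} {A : Type}
    (φ : SOForm F (A ⊕ ℕ)) : Prop :=
  ∀ (X : Type) (α : T.obj X) (V V' : A → Set X),
    (∀ a : A, V a ⊆ V' a) → φ.sat0 X α V → φ.sat0 X α V'

/-- A uniform construction for `T`. -/
structure UniformConstruction (T : SetFunctor) where
  star : (X : Type) → T.obj X → Type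
  el : (X : Type) → (α : T.obj X) → T.obj (star X α)
  h : (X : Type) → (α : T.obj X) → star X α → X
  spec : ∀ (X : Type) (α : T.obj X), T.map (h X α) (el X α) = α

/-- `SO¹_Λ` admits uniform translations: for every `k` there are a uniform construction
and an assignment of monotone (natural) predicate liftings `φ*` to monotone sentences
`φ` of quantifier depth at most `k` such that `(X,α,V) ⊨ φ*` iff
`(X_*, α_*, V_[h_α]) ⊨ φ`. -/
def AdmitsUniformTranslations {T : SetFunctor} (F : LiftingFamily T) : Prop :=
  ∀ k : ℕ, ∃ U : UniformConstruction T,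
    ∀ (A : Type) (φ : SOForm F (A ⊕ ℕ)), IsSentence φ → MonotoneSent φ → φ.qd ≤ k →
      ∃ g : GenLifting T A, g.Natural ∧ g.Mono ∧
        ∀ (X : Type) (α : T.obj X) (V : A → Set X),
          α ∈ g.app X V ↔ φ.sat0 (U.star X α) (U.el X α) (fun a => U.h X α ⁻¹' V a)

/-- Positive lattice terms over variables `A`. -/
inductive LatTerm (A : Type) : Type
  | var (a : A)
  | and (s t : LatTerm A)
  | or (s t : LatTerm A)

/-- Semantics of lattice terms. -/
def LatTerm.sem {A X : Type} : LatTerm A → (A → Set X) → Set X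
  | .var a, V => V a
  | .and s t, V => s.sem V ∩ t.sem V
  | .or s t, V => s.sem V ∪ t.sem V

/-- The modal one-step language `ML¹_Λ(A)`. -/
inductive ML1 {T : SetFunctor} (F : LiftingFamily T) (A : Type) : Type
  | bot
  | top
  | lift (i : F.ι) (ψ : Fin (F.ar i) → LatTerm A)
  | or (φ ψ : ML1 F A)
  | and (φ ψ : ML1 F A)

/-- One-step satisfaction of modal one-step formulas. -/
def ML1.sat {T : SetFunctor} {F : LiftingFamily T} {A : Type} (X : Type) (α : T.obj X)
    (V : A → Set X) : ML1 F A → Prop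
  | .bot => False
  | .top => True
  | .lift i ψ => α ∈ (F.lf i).app X (fun k => (ψ k).sem V)
  | .or φ ψ => φ.sat X α V ∨ ψ.sat X α V
  | .and φ ψ => φ.sat X α V ∧ ψ.sat X α V

/-- `Λ` is expressively complete: every monotone natural predicate lifting over a finite
variable set is expressible by a modal one-step formula over `Λ`. -/
def ExpressivelyComplete {T : SetFunctor} (F : LiftingFamily T) : Prop :=
  ∀ (A : Type), Finite A → ∀ g : GenLifting T A, g.Natural → g.Mono →
    ∃ φ : ML1 F A, ∀ (X : Type) (α : T.obj X) (V : A → Set X),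
      φ.sat X α V ↔ α ∈ g.app X V

/-- A `T`-model. -/
structure TModel (T : SetFunctor) where
  S : Type
  σ : S → T.obj S
  V : ℕ → Set S

/-- `T`-model homomorphisms. -/
def IsHom {T : SetFunctor} (M N : TModel T) (f : M.S → N.S) : Prop :=
  (∀ (p : ℕ) (x : M.S), x ∈ M.V p ↔ f x ∈ N.V p) ∧
  (∀ x : M.S, N.σ (f x) = T.map f (M.σ x))

/-- Behavioral equivalence of pointed `T`-models. -/
def BehEq {T : SetFunctor} (M : TModel T) (s : M.S) (M' : TModel T) (s' : M'.S) : Prop :=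
  ∃ (N : TModel T) (f : M.S → N.S) (g : M'.S → N.S),
    IsHom M N f ∧ IsHom M' N g ∧ f s = g s'

/-- Formulas of coalgebraic monadic second-order logic `MSO_Λ`. -/
inductive MSOForm {T : SetFunctor} (F : LiftingFamily T) : Type
  | bot
  | sr (p : ℕ)
  | subset (p q : ℕ)
  | lift (i : F.ι) (p : ℕ) (q : Fin (F.ar i) → ℕ)
  | or (φ ψ : MSOForm F)
  | neg (φ : MSOForm F)
  | ex (p : ℕ) (φ : MSOForm F)

/-- Satisfaction of `MSO_Λ`-formulas in a pointed `T`-model. -/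
def MSOForm.sat {T : SetFunctor} {F : LiftingFamily T} {S : Type} (σ : S → T.obj S) :
    MSOForm F → (ℕ → Set S) → S → Prop
  | .bot, _, _ => False
  | .sr p, V, u => V p = {u}
  | .subset p q, V, _ => V p ⊆ V q
  | .lift i p qs, V, _ => ∀ v ∈ V p, σ v ∈ (F.lf i).app S (fun k => V (qs k))
  | .or φ ψ, V, u => φ.sat σ V u ∨ ψ.sat σ V u
  | .neg φ, V, u => ¬ φ.sat σ V u
  | .ex p φ, V, u => ∃ Z : Set S, φ.sat σ (updW V p Z) u

/-- Bisimulation invariance (invariance for behavioral equivalence) of an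
`MSO_Λ`-formula. -/
def BisimInv {T : SetFunctor} {F : LiftingFamily T} (φ : MSOForm F) : Prop :=
  ∀ (M : TModel T) (s : M.S) (M' : TModel T) (s' : M'.S),
    BehEq M s M' s' → (φ.sat M.σ M.V s ↔ φ.sat M'.σ M'.V s')

/-- Formulas of the coalgebraic μ-calculus `μML_Λ` (in negation normal form). -/
inductive MuForm {T : SetFunctor} (F : LiftingFamily T) : Type
  | var (p : ℕ)
  | nvar (p : ℕ)
  | bot
  | top
  | lift (i : F.ι) (arg : Fin (F.ar i) → MuForm F)
  | or (φ ψ : MuForm F)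
  | and (φ ψ : MuForm F)
  | mu (p : ℕ) (φ : MuForm F)
  | nu (p : ℕ) (φ : MuForm F)

/-- `φ.PosIn p`: no free occurrence of `p` is negated in `φ`. -/
def MuForm.PosIn {T : SetFunctor} {F : LiftingFamily T} (p : ℕ) : MuForm F → Prop
  | .var _ => True
  | .nvar q => q ≠ p
  | .bot => True
  | .top => True
  | .lift _ arg => ∀ k, (arg k).PosIn p
  | .or φ ψ => φ.PosIn p ∧ ψ.PosIn p
  | .and φ ψ => φ.PosIn p ∧ ψ.PosIn p
  | .mu q φ => q = p ∨ φ.PosIn p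
  | .nu q φ => q = p ∨ φ.PosIn p

/-- Well-formedness of μ-calculus formulas. -/
def MuForm.WF {T : SetFunctor} {F : LiftingFamily T} : MuForm F → Prop
  | .var _ => True
  | .nvar _ => True
  | .bot => True
  | .top => True
  | .lift _ arg => ∀ k, (arg k).WF
  | .or φ ψ => φ.WF ∧ ψ.WF
  | .and φ ψ => φ.WF ∧ ψ.WF
  | .mu p φ => φ.PosIn p ∧ φ.WF
  | .nu p φ => φ.PosIn p ∧ φ.WF

/-- Semantics of `μML_Λ`: truth sets, with `μ`/`ν` as least/greatest fixpoints. -/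
noncomputable def MuForm.sem {T : SetFunctor} {F : LiftingFamily T} {S : Type}
    (σ : S → T.obj S) : MuForm F → (ℕ → Set S) → Set S
  | .var p, V => V p
  | .nvar p, V => (V p)ᶜ
  | .bot, _ => ∅
  | .top, _ => Set.univ
  | .lift i arg, V => {s : S | σ s ∈ (F.lf i).app S (fun k => (arg k).sem σ V)}
  | .or φ ψ, V => φ.sem σ V ∪ ψ.sem σ V
  | .and φ ψ, V => φ.sem σ V ∩ ψ.sem σ V
  | .mu p φ, V => ⋂₀ {Z : Set S | φ.sem σ (updW V p Z) ⊆ Z}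
  | .nu p φ, V => ⋃₀ {Z : Set S | Z ⊆ φ.sem σ (updW V p Z)}

/-- A uniform construction is adequate for `k` with respect to the liftings `F` if the
condition `(★)` holds for all monotone sentences of quantifier depth at most `k`. -/
def Adequate {T : SetFunctor} (U : UniformConstruction T) (F : LiftingFamily T)
    (k : ℕ) : Prop :=
  ∀ (X Y : Type) (f : X → Y) (α : T.obj X) (β : T.obj Y), T.map f α = β →
    ∀ (A : Type), Finite A → ∀ (V : A → Set Y) (φ : SOForm F (A ⊕ ℕ)),
      IsSentence φ → MonotoneSent φ → φ.qd ≤ k →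
        (φ.sat0 (U.star X α) (U.el X α) (fun a => (f ∘ U.h X α) ⁻¹' V a) ↔
         φ.sat0 (U.star Y β) (U.el Y β) (fun a => U.h Y β ⁻¹' V a))

/-- `T` admits an adequate uniform construction: for every `k` and every set of
monotone predicate liftings there is a uniform construction adequate for `k` with
respect to it. -/
def AdmitsAdequateUniformConstruction (T : SetFunctor) : Prop :=
  ∀ (F' : LiftingFamily T) (k : ℕ), ∃ U : UniformConstruction T, Adequate U F' k

/-! ### Parity conditions -/

/-- The largest number occurring infinitely often in `x` satisfies `E`. -/
def LimsupIn (E : ℕ → Prop) (x : ℕ → ℕ) : Prop :=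
  ∃ m, E m ∧ (∀ᶠ n in Filter.atTop, x n ≤ m) ∧ ∃ᶠ n in Filter.atTop, m ≤ x n

theorem limsup_unique {x : ℕ → ℕ} {m m' : ℕ}
    (h : ∃ᶠ n in Filter.atTop, m ≤ x n) (h' : ∀ᶠ n in Filter.atTop, x n ≤ m') : m ≤ m' := by
  obtain ⟨n, hn, hn'⟩ := (h.and_eventually h').exists
  omega

theorem exists_limsup {x : ℕ → ℕ} {N : ℕ} (h : ∀ n, x n ≤ N) :
    ∃ m, (∀ᶠ n in Filter.atTop, x n ≤ m) ∧ ∃ᶠ n in Filter.atTop, m ≤ x n := by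
  have hex : ∃ m, ∀ᶠ n in Filter.atTop, x n ≤ m := ⟨N, Filter.Eventually.of_forall h⟩
  refine ⟨Nat.find hex, Nat.find_spec hex, ?_⟩
  rw [Filter.Frequently]
  intro hcon
  rcases Nat.eq_zero_or_pos (Nat.find hex) with h0 | h0
  · obtain ⟨n, hn⟩ := hcon.exists
    omega
  · refine Nat.find_min hex (Nat.sub_lt h0 one_pos) (hcon.mono fun n hn => ?_)
    omega

theorem limsupIn_not {E : ℕ → Prop} {x : ℕ → ℕ} {N : ℕ} (h : ∀ n, x n ≤ N) :
    LimsupIn (fun m => ¬ E m) x ↔ ¬ LimsupIn E x := by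
  constructor
  · rintro ⟨m, hm, h1, h2⟩ ⟨m', hm', h1', h2'⟩
    have : m = m' := le_antisymm (limsup_unique h2 h1') (limsup_unique h2' h1)
    exact hm (this ▸ hm')
  · intro hn
    obtain ⟨m, h1, h2⟩ := exists_limsup h
    exact ⟨m, fun hm => hn ⟨m, hm, h1, h2⟩, h1, h2⟩

theorem limsupIn_true {x : ℕ → ℕ} {N : ℕ} (h : ∀ n, x n ≤ N) : LimsupIn (fun _ => True) x := by
  obtain ⟨m, h1, h2⟩ := exists_limsup h
  exact ⟨m, trivial, h1, h2⟩

theorem limsupIn_tail {E : ℕ → Prop} {x : ℕ → ℕ} (k : ℕ) :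
    LimsupIn E (fun n => x (n + k)) ↔ LimsupIn E x := by
  have h1 : ∀ m, (∀ᶠ n in Filter.atTop, x (n + k) ≤ m) ↔ ∀ᶠ n in Filter.atTop, x n ≤ m :=
    fun m => by rw [← Filter.eventually_map (m := fun n => n + k) (P := fun n => x n ≤ m),
      Filter.map_add_atTop_eq_nat]
  have h2 : ∀ m, (∃ᶠ n in Filter.atTop, m ≤ x (n + k)) ↔ ∃ᶠ n in Filter.atTop, m ≤ x n :=
    fun m => by rw [← Filter.frequently_map (m := fun n => n + k) (P := fun n => m ≤ x n),
      Filter.map_add_atTop_eq_nat]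
  simp only [LimsupIn, h1, h2]

theorem limsupIn_comp {E : ℕ → Prop} {f : ℕ → ℕ} (hf : Monotone f) {x : ℕ → ℕ} {N : ℕ}
    (h : ∀ n, x n ≤ N) : LimsupIn (fun m => E (f m)) x ↔ LimsupIn E (fun n => f (x n)) := by
  obtain ⟨m, h1, h2⟩ := exists_limsup h
  have h1' : ∀ᶠ n in Filter.atTop, f (x n) ≤ f m := h1.mono fun n hn => hf hn
  have h2' : ∃ᶠ n in Filter.atTop, f m ≤ f (x n) := h2.mono fun n hn => hf hn
  constructor
  · rintro ⟨m', hm', g1, g2⟩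
    have : m = m' := le_antisymm (limsup_unique h2 g1) (limsup_unique g2 h1)
    subst this
    exact ⟨f m, hm', h1', h2'⟩
  · rintro ⟨m', hm', g1, g2⟩
    have : f m = m' := le_antisymm (limsup_unique h2' g1) (limsup_unique g2 h1')
    subst this
    exact ⟨m, hm', h1, h2⟩

/-! ### Parity games given by monotone operators -/

section Games

variable {P : Type}

/-- A positional strategy `Y`, with domain `D`, all of whose infinite plays are won. -/
structure IsWinning (E : ℕ → Prop) (Ω : P → ℕ) (F : Set P → Set P) (D : Set P)
    (Y : P → Set P) : Prop where
  enabled : ∀ p ∈ D, p ∈ F (Y p)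
  closed : ∀ p ∈ D, Y p ⊆ D
  parity : ∀ x : ℕ → P, x 0 ∈ D → (∀ i, x (i + 1) ∈ Y (x i)) → LimsupIn E (fun i => Ω (x i))

/-- The winning region of the parity game in which, at position `p`, the first player picks a
set `Y` with `p ∈ F Y` and the second player picks the next position in `Y`. -/
def Win (E : ℕ → Prop) (Ω : P → ℕ) (F : Set P → Set P) : Set P :=
  {p | ∃ D Y, p ∈ D ∧ IsWinning E Ω F D Y}

theorem play_mem {D : Set P} {Y : P → Set P} (h : ∀ p ∈ D, Y p ⊆ D) {x : ℕ → P} (h0 : x 0 ∈ D)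
    (hx : ∀ i, x (i + 1) ∈ Y (x i)) (i : ℕ) : x i ∈ D := by
  induction i with
  | zero => exact h0
  | succ i ih => exact h _ ih (hx i)

theorem IsWinning.parity_tail {E : ℕ → Prop} {Ω : P → ℕ} {F : Set P → Set P} {D : Set P}
    {Y : P → Set P} (h : IsWinning E Ω F D Y) {x : ℕ → P} (k : ℕ) (h0 : x k ∈ D)
    (hx : ∀ i, k ≤ i → x (i + 1) ∈ Y (x i)) : LimsupIn E (fun i => Ω (x i)) := by
  rw [← limsupIn_tail k]
  refine h.parity (fun i => x (i + k)) (by simpa using h0) fun i => ?_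
  have := hx (i + k) (by omega)
  rwa [show i + k + 1 = i + 1 + k by omega] at this

/-- A winning strategy which works uniformly on the whole winning region. -/
theorem exists_isWinning_win (E : ℕ → Prop) (Ω : P → ℕ) (F : Set P → Set P) :
    ∃ Y, IsWinning E Ω F (Win E Ω F) Y := by
  obtain ⟨_, _⟩ := exists_wellFoundedLT P
  choose! D Y hD using fun (p : P) (hp : p ∈ Win E Ω F) => hp
  have hex : ∀ q ∈ Win E Ω F, ∃ m ∈ Win E Ω F, q ∈ D m ∧
      ∀ m' ∈ Win E Ω F, q ∈ D m' → m ≤ m' := by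
    intro q hq
    obtain ⟨m, ⟨hm1, hm2⟩, hmin⟩ := WellFounded.has_min (wellFounded_lt (α := P))
      {m | m ∈ Win E Ω F ∧ q ∈ D m} ⟨q, hq, (hD q hq).1⟩
    exact ⟨m, hm1, hm2, fun m' h1 h2 => not_lt.1 (hmin m' ⟨h1, h2⟩)⟩
  choose! m hm1 hm2 hm3 using hex
  have hsub : ∀ p ∈ Win E Ω F, D p ⊆ Win E Ω F := fun p hp q hq => ⟨D p, Y p, hq, (hD p hp).2⟩
  have hclosed : ∀ q ∈ Win E Ω F, Y (m q) q ⊆ Win E Ω F := fun q hq =>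
    ((hD _ (hm1 q hq)).2.closed q (hm2 q hq)).trans (hsub _ (hm1 q hq))
  refine ⟨fun q => Y (m q) q, fun q hq => (hD _ (hm1 q hq)).2.enabled q (hm2 q hq), hclosed, ?_⟩
  intro x h0 hx
  have hmem : ∀ i, x i ∈ Win E Ω F := play_mem (Y := fun q => Y (m q) q) hclosed h0 hx
  have hanti : Antitone fun i => m (x i) := antitone_nat_of_succ_le fun i =>
    hm3 _ (hmem _) _ (hm1 _ (hmem i))
      ((hD _ (hm1 _ (hmem i))).2.closed _ (hm2 _ (hmem i)) (hx i))
  obtain ⟨a, ⟨k, rfl⟩, hk⟩ := WellFounded.has_min (wellFounded_lt (α := P))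
    (Set.range fun i => m (x i)) ⟨_, 0, rfl⟩
  have hconst : ∀ i, k ≤ i → m (x i) = m (x k) := fun i hi =>
    le_antisymm (hanti hi) (not_lt.1 (hk _ ⟨i, rfl⟩))
  refine (hD _ (hm1 _ (hmem k))).2.parity_tail k (hm2 _ (hmem k)) fun i hi => ?_
  have := hx i
  rwa [hconst i hi] at this

/-- It suffices that the plays from the initial position are won. -/
theorem mem_win_of_start {E : ℕ → Prop} {Ω : P → ℕ} {F : Set P → Set P} {D : Set P}
    {Y : P → Set P} {p : P} (hp : p ∈ D) (h1 : ∀ p ∈ D, p ∈ F (Y p)) (h2 : ∀ p ∈ D, Y p ⊆ D)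
    (h3 : ∀ x : ℕ → P, x 0 = p → (∀ i, x (i + 1) ∈ Y (x i)) → LimsupIn E (fun i => Ω (x i))) :
    p ∈ Win E Ω F := by
  refine ⟨{q | q ∈ D ∧ ∃ (n : ℕ) (x : ℕ → P), x 0 = p ∧ x n = q ∧
    ∀ i < n, x (i + 1) ∈ Y (x i)}, Y, ⟨hp, 0, fun _ => p, rfl, rfl, by simp⟩, ?_, ?_, ?_⟩
  · exact fun q hq => h1 q hq.1
  · rintro q ⟨hq, n, x, hx0, rfl, hx⟩ r hr
    refine ⟨h2 _ hq hr, n + 1, fun i => if i ≤ n then x i else r, by simpa using hx0, by simp, ?_⟩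
    intro i hi
    rcases Nat.lt_succ_iff_lt_or_eq.1 hi with h | h
    · simpa [h.le, Nat.succ_le_of_lt h] using hx i h
    · subst h; simpa using hr
  · rintro y ⟨hq, n, x, hx0, hxn, hx⟩ hy
    have := h3 (fun i => if i ≤ n then x i else y (i - n)) (by simpa using hx0) fun i => by
      rcases lt_trichotomy i n with h | h | h
      · simpa [h.le, Nat.succ_le_of_lt h] using hx i h
      · subst h
        simpa [hxn] using hy 0
      · have h' : ¬ i ≤ n := by omega
        have h'' : ¬ i + 1 ≤ n := by omega
        simp only [h', h'', if_false]
        rw [show i + 1 - n = i - n + 1 by omega]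
        exact hy _
    rw [← limsupIn_tail n] at this
    convert this using 3 with i
    rcases Nat.eq_zero_or_pos i with h | h
    · subst h; simp [hxn]
    · have : ¬ i + n ≤ n := by omega
      simp [this]

/-- The winning region is a fixpoint. -/
theorem win_fixpoint {E : ℕ → Prop} {Ω : P → ℕ} {F : Set P → Set P} (hF : Monotone F) :
    F (Win E Ω F) = Win E Ω F := by
  obtain ⟨Y, hY⟩ := exists_isWinning_win E Ω F
  apply subset_antisymm
  · intro p hp
    refine ⟨insert p (Win E Ω F), fun q => if q ∈ Win E Ω F then Y q else Win E Ω F,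
      Set.mem_insert _ _, ?_, ?_, ?_⟩
    · rintro q (rfl | hq)
      · by_cases h : q ∈ Win E Ω F
        · simpa [h] using hY.enabled q h
        · simpa [h] using hp
      · simpa [hq] using hY.enabled q hq
    · intro q _
      split_ifs with h
      · exact (hY.closed q h).trans (Set.subset_insert _ _)
      · exact Set.subset_insert _ _
    · intro x _ hx
      have h1 : x 1 ∈ Win E Ω F := by
        have := hx 0
        split_ifs at this with h
        · exact hY.closed _ h this
        · exact this
      have hmem : ∀ i, x (i + 1) ∈ Win E Ω F := by
        intro i
        induction i with
        | zero => exact h1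
        | succ i ih => have := hx (i + 1); rw [if_pos ih] at this; exact hY.closed _ ih this
      refine hY.parity_tail 1 h1 fun i hi => ?_
      have := hx i
      rwa [if_pos] at this
      obtain ⟨j, rfl⟩ := Nat.exists_eq_add_of_le' hi
      exact hmem j
  · exact fun p hp => hF (hY.closed p hp) (hY.enabled p hp)

theorem win_true_of_postfixed {Ω : P → ℕ} {N : ℕ} (hN : ∀ p, Ω p ≤ N) {F : Set P → Set P}
    {D : Set P} (hD : D ⊆ F D) : D ⊆ Win (fun _ => True) Ω F := fun _ hp =>
  ⟨D, fun _ => D, hp, hD, fun _ _ => subset_rfl, fun _ _ _ => limsupIn_true fun _ => hN _⟩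

/-- Nested fixpoints: least and greatest fixpoints alternate according to `E`, the outermost
fixpoint belonging to the largest priority below `n`. -/
def nestedFix (E : ℕ → Prop) (Ω : P → ℕ) : ℕ → (Set P → Set P) → Set P
  | 0, F => F ∅
  | n + 1, F =>
    if E n then
      ⋃₀ {Z | Z ⊆ nestedFix E Ω n fun Y => F (Y ∩ {p | Ω p < n} ∪ Z ∩ {p | Ω p = n})}
    else
      ⋂₀ {Z | nestedFix E Ω n (fun Y => F (Y ∩ {p | Ω p < n} ∪ Z ∩ {p | Ω p = n})) ⊆ Z}

theorem nestedFix_mono {E : ℕ → Prop} {Ω : P → ℕ} (n : ℕ) {F F' : Set P → Set P}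
    (h : ∀ Y, F Y ⊆ F' Y) : nestedFix E Ω n F ⊆ nestedFix E Ω n F' := by
  induction n generalizing F F' with
  | zero => exact h ∅
  | succ n ih =>
    simp only [nestedFix]
    split_ifs
    · exact Set.sUnion_subset_sUnion fun Z hZ => Set.Subset.trans hZ (ih fun Y => h _)
    · exact Set.sInter_subset_sInter fun Z hZ => Set.Subset.trans (ih fun Y => h _) hZ

theorem inner_mono {F : Set P → Set P} (hF : Monotone F) (A B Z : Set P) :
    Monotone fun Y => F (Y ∩ A ∪ Z ∩ B) := fun _ _ h =>
  hF (Set.union_subset_union_left _ (Set.inter_subset_inter_left _ h))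

theorem nestedFix_inner_mono {E : ℕ → Prop} {Ω : P → ℕ} (n : ℕ) {F : Set P → Set P}
    (hF : Monotone F) (A B : Set P) :
    Monotone fun Z => nestedFix E Ω n fun Y => F (Y ∩ A ∪ Z ∩ B) := fun _ _ h =>
  nestedFix_mono n fun _ => hF (Set.union_subset_union_right _ (Set.inter_subset_inter_left _ h))

theorem nestedFix_subset_win {E : ℕ → Prop} {Ω : P → ℕ} (n : ℕ) {F : Set P → Set P}
    (hF : Monotone F) : nestedFix E Ω n F ⊆ Win E Ω F := by
  induction n generalizing F with
  | zero =>
    intro p hp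
    exact ⟨{p}, fun _ => ∅, rfl, by rintro q rfl; exact hp, fun _ _ => Set.empty_subset _,
      fun x _ hx => absurd (hx 0) (Set.notMem_empty _)⟩
  | succ n ih =>
    simp only [nestedFix]
    split_ifs with hE
    · set G := fun Z => nestedFix E Ω n fun Y => F (Y ∩ {p | Ω p < n} ∪ Z ∩ {p | Ω p = n})
        with hG
      have hGm : Monotone G := nestedFix_inner_mono n hF _ _
      set Z := ⋃₀ {Z | Z ⊆ G Z} with hZ
      have hZG : Z ⊆ G Z := Set.sUnion_subset fun Z' hZ' =>
        Set.Subset.trans hZ' (hGm (Set.subset_sUnion_of_mem hZ'))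
      have hsub := hZG.trans (ih (inner_mono hF {p | Ω p < n} {p | Ω p = n} Z))
      obtain ⟨Y, hY⟩ := exists_isWinning_win E Ω
        fun Y => F (Y ∩ {p | Ω p < n} ∪ Z ∩ {p | Ω p = n})
      intro p hp
      refine ⟨_, fun q => Y q ∩ {p | Ω p < n} ∪ Z ∩ {p | Ω p = n}, hsub hp,
        hY.enabled, ?_, ?_⟩
      · rintro q hq r (hr | hr)
        · exact hY.closed q hq hr.1
        · exact hsub hr.1
      · intro x h0 hx
        by_cases hfr : ∃ᶠ i in Filter.atTop, Ω (x i) = n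
        · refine ⟨n, hE, Filter.eventually_atTop.2 ⟨1, fun i hi => ?_⟩,
            hfr.mono fun i hi => hi.ge⟩
          obtain ⟨j, rfl⟩ := Nat.exists_eq_add_of_le' hi
          rcases hx j with h | h
          · exact h.2.le
          · exact h.2.le
        · rw [Filter.not_frequently, Filter.eventually_atTop] at hfr
          obtain ⟨k, hk⟩ := hfr
          have hcl : ∀ q ∈ Win E Ω fun Y => F (Y ∩ {p | Ω p < n} ∪ Z ∩ {p | Ω p = n}),
              Y q ∩ {p | Ω p < n} ∪ Z ∩ {p | Ω p = n} ⊆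
                Win E Ω fun Y => F (Y ∩ {p | Ω p < n} ∪ Z ∩ {p | Ω p = n}) :=
            fun q hq => Set.union_subset (Set.inter_subset_left.trans (hY.closed q hq))
              (Set.inter_subset_left.trans hsub)
          refine hY.parity_tail k (play_mem hcl h0 hx k) fun i hi => ?_
          rcases hx i with h | h
          · exact h.1
          · exact absurd h.2 (hk (i + 1) (by omega))
    · refine Set.sInter_subset_of_mem ?_
      set W := Win E Ω F with hW
      refine Set.Subset.trans (ih (inner_mono hF {p | Ω p < n} {p | Ω p = n} W)) ?_
      obtain ⟨Y, hY⟩ := exists_isWinning_win E Ω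
        fun Y => F (Y ∩ {p | Ω p < n} ∪ W ∩ {p | Ω p = n})
      obtain ⟨YW, hYW⟩ := exists_isWinning_win E Ω F
      set D := Win E Ω fun Y => F (Y ∩ {p | Ω p < n} ∪ W ∩ {p | Ω p = n})
      intro p hp
      have hcl : ∀ q ∈ W ∪ D,
          (if q ∈ W then YW q else Y q ∩ {p | Ω p < n} ∪ W ∩ {p | Ω p = n}) ⊆ W ∪ D := by
        intro q hq
        split_ifs with h
        · exact (hYW.closed q h).trans Set.subset_union_left
        · refine Set.union_subset (Set.inter_subset_left.trans ?_)
            (Set.inter_subset_left.trans Set.subset_union_left)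
          exact (hY.closed q (hq.resolve_left h)).trans Set.subset_union_right
      refine ⟨W ∪ D, fun q => if q ∈ W then YW q else
        Y q ∩ {p | Ω p < n} ∪ W ∩ {p | Ω p = n}, Or.inr hp, ?_, hcl, ?_⟩
      · intro q hq
        split_ifs with h
        · exact hYW.enabled q h
        · exact hY.enabled q (hq.resolve_left h)
      · intro x h0 hx
        by_cases hex : ∃ k, x k ∈ W
        · obtain ⟨k, hk⟩ := hex
          have hmem : ∀ i, k ≤ i → x i ∈ W := fun i hi => by
            induction i, hi using Nat.le_induction with
            | base => exact hk
            | succ i _ ih => have := hx i; rw [if_pos ih] at this; exact hYW.closed _ ih this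
          refine hYW.parity_tail k hk fun i hi => ?_
          have := hx i
          rwa [if_pos (hmem i hi)] at this
        · push Not at hex
          refine hY.parity x (h0.resolve_left (hex 0)) fun i => ?_
          have := hx i
          rw [if_neg (hex i)] at this
          exact (this.resolve_right fun h => hex _ h.1).1

/-- The dual of an operator on sets. -/
def dualOp (F : Set P → Set P) (Y : Set P) : Set P := (F Yᶜ)ᶜ

theorem dualOp_mono {F : Set P → Set P} (hF : Monotone F) : Monotone (dualOp F) := fun _ _ h =>
  Set.compl_subset_compl.2 (hF (Set.compl_subset_compl.2 h))

theorem compl_nestedFix {E : ℕ → Prop} {Ω : P → ℕ} (n : ℕ) {F : Set P → Set P}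
    (hF : ∀ Y, F (Y ∩ {p | Ω p < n}) = F Y) :
    (nestedFix E Ω n F)ᶜ = nestedFix (fun m => ¬ E m) Ω n (dualOp F) := by
  induction n generalizing F with
  | zero =>
    have := hF Set.univ
    simp only [Nat.not_lt_zero, Set.ofPred_false, Set.inter_empty] at this
    simp [nestedFix, dualOp, this]
  | succ n ih =>
    have key : ∀ Z : Set P,
        (nestedFix E Ω n fun Y => F (Y ∩ {p | Ω p < n} ∪ Z ∩ {p | Ω p = n}))ᶜ =
        nestedFix (fun m => ¬ E m) Ω n
          fun Y => dualOp F (Y ∩ {p | Ω p < n} ∪ Zᶜ ∩ {p | Ω p = n}) := by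
      intro Z
      rw [ih fun Y => by simp [Set.inter_assoc]]
      congr 1
      funext Y
      simp only [dualOp]
      rw [← hF (Y ∩ _ ∪ _)ᶜ]
      congr 2
      ext p
      simp only [Set.mem_union, Set.mem_inter_iff, Set.mem_compl_iff, Set.mem_ofPred_eq]
      rcases lt_trichotomy (Ω p) n with h | h | h
      · simp [h, h.ne, Nat.lt_succ_of_lt h]
      · simp [h]
      · simp [h.not_gt, h.ne', Nat.not_lt.2 h]
    simp only [nestedFix]
    by_cases hE : E n
    · simp only [hE, if_true, not_true, if_false]
      ext p
      simp only [Set.mem_compl_iff, Set.mem_sUnion, Set.mem_sInter, Set.mem_ofPred_eq, not_exists,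
        not_and]
      constructor
      · intro h Z hZ
        by_contra hp
        refine h Zᶜ ?_ hp
        rw [← Set.compl_subset_compl, key]
        simpa using hZ
      · intro h Z hZ hp
        refine h Zᶜ ?_ hp
        rw [← key]
        exact Set.compl_subset_compl.2 hZ
    · simp only [hE, if_false, not_false_iff, if_true]
      ext p
      simp only [Set.mem_compl_iff, Set.mem_sUnion, Set.mem_sInter, Set.mem_ofPred_eq, not_forall]
      constructor
      · rintro ⟨Z, hZ, hp⟩
        refine ⟨Zᶜ, ?_, hp⟩
        rw [← key]
        exact Set.compl_subset_compl.2 hZ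
      · rintro ⟨Z, hZ, hp⟩
        refine ⟨Zᶜ, ?_, fun h => h hp⟩
        rw [← Set.compl_subset_compl, key]
        simpa using hZ

theorem win_inter_win_dual {E : ℕ → Prop} {Ω : P → ℕ} {N : ℕ} (hN : ∀ p, Ω p ≤ N)
    {F : Set P → Set P} (hF : Monotone F) {p : P} (h : p ∈ Win E Ω F)
    (h' : p ∈ Win (fun m => ¬ E m) Ω (dualOp F)) : False := by
  obtain ⟨D, Y, hp, hY⟩ := h
  obtain ⟨D', Y', hp', hY'⟩ := h'
  have hex : ∀ q : {q // q ∈ D ∧ q ∈ D'}, ∃ r : {q // q ∈ D ∧ q ∈ D'},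
      r.1 ∈ Y q.1 ∧ r.1 ∈ Y' q.1 := by
    rintro ⟨q, hq, hq'⟩
    by_contra hcon
    have hsub : Y q ⊆ (Y' q)ᶜ := fun r hr hr' => hcon ?_
    · exact hY'.enabled q hq' (hF hsub (hY.enabled q hq))
    exact ⟨⟨r, hY.closed q hq hr, hY'.closed q hq' hr'⟩, hr, hr'⟩
  choose nxt h1 h2 using hex
  have hx0 : (Nat.rec ⟨p, hp, hp'⟩ (fun _ q => nxt q) 0 : {q // q ∈ D ∧ q ∈ D'}) = ⟨p, hp, hp'⟩ :=
    rfl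
  set x : ℕ → {q // q ∈ D ∧ q ∈ D'} := fun i => Nat.rec ⟨p, hp, hp'⟩ (fun _ q => nxt q) i
  have hg := hY.parity (fun i => (x i).1) (x 0).2.1 fun i => h1 (x i)
  have hg' := hY'.parity (fun i => (x i).1) (x 0).2.2 fun i => h2 (x i)
  exact (limsupIn_not fun i => hN _).1 hg' hg

theorem win_eq_nestedFix {E : ℕ → Prop} {Ω : P → ℕ} {n : ℕ} (hn : ∀ p, Ω p < n)
    {F : Set P → Set P} (hF : Monotone F) : Win E Ω F = nestedFix E Ω n F := by
  apply subset_antisymm _ (nestedFix_subset_win n hF)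
  intro p hp
  by_contra hcon
  change p ∈ (nestedFix E Ω n F)ᶜ at hcon
  rw [compl_nestedFix n fun Y => by simp [hn]] at hcon
  exact win_inter_win_dual (fun p => (hn p).le) hF hp
    (nestedFix_subset_win n (dualOp_mono hF) hcon)

/-- Positional determinacy of parity games. -/
theorem compl_win {E : ℕ → Prop} {Ω : P → ℕ} {n : ℕ} (hn : ∀ p, Ω p < n)
    {F : Set P → Set P} (hF : Monotone F) :
    (Win E Ω F)ᶜ = Win (fun m => ¬ E m) Ω (dualOp F) := by
  rw [win_eq_nestedFix hn hF, win_eq_nestedFix hn (dualOp_mono hF),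
    compl_nestedFix n fun Y => by simp [hn]]

theorem win_congr_parity {E E' : ℕ → Prop} {Ω Ω' : P → ℕ} {F : Set P → Set P}
    (h : ∀ x : ℕ → P, LimsupIn E (fun i => Ω (x i)) ↔ LimsupIn E' (fun i => Ω' (x i))) :
    Win E Ω F = Win E' Ω' F := by
  ext p
  refine exists_congr fun D => exists_congr fun Y => and_congr_right fun _ => ?_
  exact ⟨fun hw => ⟨hw.1, hw.2, fun x h0 hx => (h x).1 (hw.3 x h0 hx)⟩,
    fun hw => ⟨hw.1, hw.2, fun x h0 hx => (h x).2 (hw.3 x h0 hx)⟩⟩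

/-- Winning positions are preserved and reflected by maps commuting with the operators. -/
theorem mem_win_comap {P' : Type} {E E' : ℕ → Prop} {Ω : P → ℕ} {Ω' : P' → ℕ} {F : Set P → Set P}
    {F' : Set P' → Set P'} (f : P' → P) (hc : ∀ Y, f ⁻¹' F Y = F' (f ⁻¹' Y))
    (hp : ∀ x : ℕ → P', LimsupIn E (fun i => Ω (f (x i))) ↔ LimsupIn E' (fun i => Ω' (x i)))
    {n n' : ℕ} (hn : ∀ p, Ω p < n) (hn' : ∀ p, Ω' p < n') (hF : Monotone F) (hF' : Monotone F')
    (p : P') : p ∈ Win E' Ω' F' ↔ f p ∈ Win E Ω F := by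
  have key : ∀ {E E' : ℕ → Prop} {F : Set P → Set P} {F' : Set P' → Set P'},
      (∀ Y, f ⁻¹' F Y = F' (f ⁻¹' Y)) →
      (∀ x : ℕ → P', LimsupIn E (fun i => Ω (f (x i))) ↔ LimsupIn E' (fun i => Ω' (x i))) →
      f p ∈ Win E Ω F → p ∈ Win E' Ω' F' := by
    rintro E E' F F' hc hp ⟨D, Y, hD, hY⟩
    refine ⟨f ⁻¹' D, fun q => f ⁻¹' Y (f q), hD, ?_, ?_, ?_⟩
    · intro q hq
      rw [← hc]
      exact hY.enabled _ hq
    · exact fun q hq r hr => hY.closed _ hq hr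
    · exact fun x h0 hx => (hp x).1 (hY.parity (fun i => f (x i)) h0 hx)
  refine ⟨fun h => ?_, key hc hp⟩
  by_contra hcon
  change f p ∈ (Win E Ω F)ᶜ at hcon
  rw [compl_win hn hF] at hcon
  refine win_inter_win_dual (fun p => (hn' p).le) hF' h (key (fun Y => ?_) (fun x => ?_) hcon)
  · simp only [dualOp, Set.preimage_compl, hc]
  · rw [limsupIn_not fun i => (hn _).le, limsupIn_not fun i => (hn' _).le, hp]

end Games

/-! ### Determinization of tail conditions on words -/

theorem exists_frequently_of_finite {ι : Type} {s : Set ι} (hs : s.Finite) {p : ι → ℕ → Prop}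
    (h : ∃ᶠ k in Filter.atTop, ∃ i ∈ s, p i k) : ∃ i ∈ s, ∃ᶠ k in Filter.atTop, p i k := by
  by_contra hcon
  push Not at hcon
  have : ∀ᶠ k in Filter.atTop, ∀ i ∈ s, ¬ p i k :=
    (Filter.eventually_all_finite hs).2 fun i hi => hcon i hi
  exact h (this.mono fun k hk ⟨i, hi, hp⟩ => hk i hi hp)

section Determinization

variable {M L : Type}

/-- The state at time `k` of the deterministic automaton started at time `i` on the word `w`. -/
def runFrom (one : M) (act : M → L → M) (w : ℕ → L) (i : ℕ) : ℕ → M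
  | 0 => one
  | k + 1 => if i ≤ k then act (runFrom one act w i k) (w k) else one

variable {one : M} {act : M → L → M} {w : ℕ → L}

theorem runFrom_succ {i k : ℕ} (h : i ≤ k) :
    runFrom one act w i (k + 1) = act (runFrom one act w i k) (w k) := by
  simp [runFrom, h]

theorem runFrom_self (i : ℕ) : runFrom one act w i i = one := by
  cases i <;> simp [runFrom]

theorem runFrom_ne_one (hact : ∀ m a, act m a ≠ one) {i k : ℕ} (h : i < k) :
    runFrom one act w i k ≠ one := by
  obtain ⟨k, rfl⟩ := Nat.exists_eq_succ_of_ne_zero (by omega : k ≠ 0)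
  rw [Nat.succ_eq_add_one, runFrom_succ (by omega)]
  exact hact _ _

theorem runFrom_eq_of_le {i j k k' : ℕ} (hi : i ≤ k) (hj : j ≤ k) (hk : k ≤ k')
    (h : runFrom one act w i k = runFrom one act w j k) :
    runFrom one act w i k' = runFrom one act w j k' := by
  induction k', hk using Nat.le_induction with
  | base => exact h
  | succ n hn ih => rw [runFrom_succ (by omega), runFrom_succ (by omega), ih]

/-- `i` is the earliest starting time of the runs which agree at time `k` with the run started
at time `i`. -/
def IsRep (one : M) (act : M → L → M) (w : ℕ → L) (k i : ℕ) : Prop :=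
  i ≤ k ∧ ∀ i' < i, runFrom one act w i' k ≠ runFrom one act w i k

theorem isRep_self (hact : ∀ m a, act m a ≠ one) (k : ℕ) : IsRep one act w k k :=
  ⟨le_rfl, fun i' hi' => by rw [runFrom_self k]; exact runFrom_ne_one hact hi'⟩

theorem IsRep.anti {i k k' : ℕ} (hi : i ≤ k) (hk : k ≤ k') (h : IsRep one act w k' i) :
    IsRep one act w k i :=
  ⟨hi, fun i' hi' he => h.2 i' hi' (runFrom_eq_of_le (by omega) hi hk he)⟩

theorem exists_isRep {i k : ℕ} (hi : i ≤ k) :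
    ∃ j ≤ i, IsRep one act w k j ∧ runFrom one act w j k = runFrom one act w i k := by
  have hex : ∃ j, runFrom one act w j k = runFrom one act w i k := ⟨i, rfl⟩
  refine ⟨Nat.find hex, Nat.find_min' hex rfl,
    ⟨(Nat.find_min' hex rfl).trans hi, fun i' hi' he => ?_⟩, Nat.find_spec hex⟩
  exact Nat.find_min hex hi' (he.trans (Nat.find_spec hex))

/-- The run started at time `i` never merges with an earlier one. -/
def IsPerm (one : M) (act : M → L → M) (w : ℕ → L) (i : ℕ) : Prop :=
  ∀ k, i ≤ k → IsRep one act w k i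

theorem eventually_isRep_iff (i : ℕ) :
    ∀ᶠ k in Filter.atTop, (IsRep one act w k i ↔ IsPerm one act w i) := by
  by_cases h : IsPerm one act w i
  · exact Filter.eventually_atTop.2 ⟨i, fun k hk => iff_of_true (h k hk) h⟩
  · have h' := h
    simp only [IsPerm, not_forall] at h'
    obtain ⟨k, hk, hn⟩ := h'
    exact Filter.eventually_atTop.2
      ⟨k, fun k' hk' => iff_of_false (fun hr => hn (hr.anti hk hk')) h⟩

theorem exists_isPerm (j : ℕ) : ∃ i ≤ j, IsPerm one act w i ∧
    ∃ K, j ≤ K ∧ runFrom one act w i K = runFrom one act w j K := by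
  have hex : ∃ i, i ≤ j ∧ ∃ K, j ≤ K ∧ runFrom one act w i K = runFrom one act w j K :=
    ⟨j, le_rfl, j, le_rfl, rfl⟩
  obtain ⟨hij, K, hK, he⟩ := Nat.find_spec hex
  refine ⟨Nat.find hex, hij, fun k hk => ⟨hk, fun i' hi' he' => ?_⟩, K, hK, he⟩
  refine Nat.find_min hex hi' ⟨by omega, max k K, by omega, ?_⟩
  rw [runFrom_eq_of_le (by omega) hk (le_max_left k K) he',
    runFrom_eq_of_le (by omega) hK (le_max_right k K) he]

theorem isPerm_finite [Finite M] : {i | IsPerm one act w i}.Finite := by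
  have := Fintype.ofFinite M
  by_contra hinf
  obtain ⟨t, ht, hcard⟩ := Set.Infinite.exists_subset_card_eq hinf (Fintype.card M + 1)
  obtain ⟨i, hi, j, hj, hne, he⟩ := Finset.exists_ne_map_eq_of_card_lt_of_maps_to
    (s := t) (t := Finset.univ) (f := fun i => runFrom one act w i (t.sup id))
    (by rw [hcard, Finset.card_univ]; omega) (fun _ _ => by simp)
  have hle : ∀ i ∈ t, i ≤ t.sup id := fun i hi => Finset.le_sup (f := id) hi
  rcases lt_or_gt_of_ne hne with h | h
  · exact (ht hj _ (hle j hj)).2 i h he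
  · exact (ht hi _ (hle i hi)).2 j h he.symm

/-- At time `k + 1` some run, started when the run from `i` was in state `e`, merges into the
run from `i`. -/
def RunAbsorbs (one : M) (act : M → L → M) (w : ℕ → L) (e : M) (i k : ℕ) : Prop :=
  ∃ j, i < j ∧ IsRep one act w k j ∧
    runFrom one act w i (k + 1) = runFrom one act w j (k + 1) ∧ runFrom one act w i j = e

theorem exists_factorization {e : M} {i : ℕ}
    (h : ∃ᶠ k in Filter.atTop, RunAbsorbs one act w e i k) :
    ∃ j : ℕ → ℕ, StrictMono j ∧ j 0 = i ∧ ∀ n, runFrom one act w (j n) (j (n + 1)) = e := by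
  have hJ : ∀ b, ∃ j, b < j ∧ runFrom one act w i j = e ∧
      ∃ K, j ≤ K ∧ runFrom one act w i K = runFrom one act w j K := by
    intro b
    have hev : ∀ j, ∀ᶠ k in Filter.atTop, ¬ (i < j ∧ IsRep one act w k j ∧
        runFrom one act w i (k + 1) = runFrom one act w j (k + 1) ∧
        runFrom one act w i j = e) := by
      intro j
      by_cases hj : ∃ k, i < j ∧ IsRep one act w k j ∧
        runFrom one act w i (k + 1) = runFrom one act w j (k + 1) ∧ runFrom one act w i j = e
      · obtain ⟨k0, hij, hr, he, _⟩ := hj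
        refine Filter.eventually_atTop.2 ⟨k0 + 1, fun k hk hc => hc.2.1.2 i hij ?_⟩
        exact runFrom_eq_of_le (by have := hr.1; omega) (by have := hr.1; omega) hk he
      · exact Filter.Eventually.of_forall fun k hk => hj ⟨k, hk⟩
    have hall := (Filter.eventually_all_finite (Set.finite_Iic b)).2 fun j _ => hev j
    obtain ⟨k, ⟨j, h1, h2, h3, h4⟩, hk⟩ := (h.and_eventually hall).exists
    refine ⟨j, ?_, h4, k + 1, by have := h2.1; omega, h3⟩
    by_contra hb
    exact hk j (not_lt.1 hb) ⟨h1, h2, h3, h4⟩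
  have hnext : ∀ j : {j // ∃ K, j ≤ K ∧ i ≤ K ∧ runFrom one act w i K = runFrom one act w j K},
      ∃ j' : {j // ∃ K, j ≤ K ∧ i ≤ K ∧ runFrom one act w i K = runFrom one act w j K},
        j.1 < j'.1 ∧ runFrom one act w j.1 j'.1 = e := by
    rintro ⟨j, K, hjK, hiK, he⟩
    obtain ⟨j', hlt, he', K', hK', heK'⟩ := hJ K
    refine ⟨⟨j', K', hK', by omega, heK'⟩, by simp only; omega, ?_⟩
    rw [← he']
    exact (runFrom_eq_of_le hiK hjK hlt.le he).symm
  choose nxt h1 h2 using hnext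
  let x : ℕ → {j // ∃ K, j ≤ K ∧ i ≤ K ∧ runFrom one act w i K = runFrom one act w j K} :=
    fun n => Nat.rec ⟨i, i, le_rfl, le_rfl, rfl⟩ (fun _ j => nxt j) n
  exact ⟨fun n => (x n).1, strictMono_nat_of_lt_succ fun n => h1 (x n), rfl, fun n => h2 (x n)⟩

theorem exists_isPerm_absorbs [Finite M] (hact : ∀ m a, act m a ≠ one) :
    ∃ i e, IsPerm one act w i ∧ ∃ᶠ k in Filter.atTop, RunAbsorbs one act w e i k := by
  have hfr : ∃ᶠ k in Filter.atTop, ∃ i ∈ {i | IsPerm one act w i},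
      ∃ e ∈ Set.univ, RunAbsorbs one act w e i k := by
    rw [Filter.frequently_atTop]
    intro b
    obtain ⟨j, hbj, hj⟩ : ∃ j, b ≤ j ∧ ¬ IsPerm one act w j := by
      obtain ⟨B, hB⟩ := (isPerm_finite (one := one) (act := act) (w := w)).bddAbove
      exact ⟨max b (B + 1), le_max_left _ _, fun h => by
        have := hB h
        have := le_max_right b (B + 1)
        omega⟩
    obtain ⟨i, hij, hi, hK⟩ := exists_isPerm (one := one) (act := act) (w := w) j
    have hlt : i < j := lt_of_le_of_ne hij fun h => hj (h ▸ hi)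
    obtain ⟨hjK, he⟩ := Nat.find_spec hK
    have hmin : ∀ k, k < Nat.find hK → j ≤ k → runFrom one act w i k ≠ runFrom one act w j k :=
      fun k hk hjk hek => Nat.find_min hK hk ⟨hjk, hek⟩
    have hne : Nat.find hK ≠ j := fun h => by
      rw [h, runFrom_self j] at he
      exact runFrom_ne_one hact hlt he
    obtain ⟨k, hk⟩ := Nat.exists_eq_succ_of_ne_zero (by omega : Nat.find hK ≠ 0)
    rw [hk, Nat.succ_eq_add_one] at he
    have hjk : j ≤ k := by omega
    obtain ⟨j', hj', hr, hej⟩ := exists_isRep (one := one) (act := act) (w := w) hjk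
    have hek : runFrom one act w j' (k + 1) = runFrom one act w j (k + 1) :=
      runFrom_eq_of_le (by omega) hjk (by omega) hej
    refine ⟨k, hbj.trans hjk, i, hi, _, Set.mem_univ _, j', ?_, hr, he.trans hek.symm, rfl⟩
    rcases lt_trichotomy i j' with h | h | h
    · exact h
    · subst h
      exact absurd hej (hmin k (by omega) hjk)
    · exact absurd (hek.trans he.symm) ((hi (k + 1) (by omega)).2 j' h)
  obtain ⟨i, hi, hfr⟩ := exists_frequently_of_finite isPerm_finite hfr
  obtain ⟨e, -, hfr⟩ := exists_frequently_of_finite Set.finite_univ hfr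
  exact ⟨i, e, hi, hfr⟩

/-- The number of representatives at time `k` which are smaller than `i`. -/
noncomputable def repPos (one : M) (act : M → L → M) (w : ℕ → L) (k i : ℕ) : ℕ :=
  Set.ncard {i' | i' < i ∧ IsRep one act w k i'}

theorem repPos_lt {k i j : ℕ} (hi : IsRep one act w k i) (h : i < j) :
    repPos one act w k i < repPos one act w k j :=
  Set.ncard_lt_ncard ⟨fun _ hx => ⟨hx.1.trans h, hx.2⟩, fun hs => lt_irrefl i (hs ⟨h, hi⟩).1⟩
    ((Set.finite_Iio j).subset fun _ hx => hx.1)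

/-- At time `k + 1` the representative at position `r` is lost. -/
def LostAt (one : M) (act : M → L → M) (w : ℕ → L) (r k : ℕ) : Prop :=
  ∃ i, IsRep one act w k i ∧ ¬ IsRep one act w (k + 1) i ∧ repPos one act w k i = r

/-- At time `k + 1` the representative at position `r` witnesses acceptance. -/
def GoodAt (one : M) (act : M → L → M) (acc : M → M → Prop) (w : ℕ → L) (r k : ℕ) : Prop :=
  ∃ i e, IsRep one act w k i ∧ repPos one act w k i = r ∧ RunAbsorbs one act w e i k ∧
    acc (runFrom one act w 0 i) e

theorem accepted_iff_goodAt [Finite M] (hact : ∀ m a, act m a ≠ one) {acc : M → M → Prop}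
    {Q : Prop} (hQ : ∀ (j : ℕ → ℕ) (e : M), StrictMono j →
      (∀ n, runFrom one act w (j n) (j (n + 1)) = e) →
      (Q ↔ acc (runFrom one act w 0 (j 0)) e)) :
    Q ↔ ∃ r, (∃ᶠ k in Filter.atTop, GoodAt one act acc w r k) ∧
      ∀ r' ≤ r, ∀ᶠ k in Filter.atTop, ¬ LostAt one act w r' k := by
  constructor
  · intro hq
    obtain ⟨i, e, hi, hfr⟩ := exists_isPerm_absorbs (one := one) (act := act) (w := w) hact
    obtain ⟨j, hj, rfl, hje⟩ := exists_factorization hfr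
    have hacc := (hQ j e hj hje).1 hq
    set i := j 0
    have hev : ∀ᶠ k in Filter.atTop, ∀ i' ≤ i, (IsRep one act w k i' ↔ IsPerm one act w i') :=
      (Filter.eventually_all_finite (Set.finite_Iic i)).2 fun i' _ => eventually_isRep_iff i'
    have hpos : ∀ᶠ k in Filter.atTop,
        repPos one act w k i = Set.ncard {i' | i' < i ∧ IsPerm one act w i'} := by
      refine hev.mono fun k hk => ?_
      unfold repPos
      congr 1
      ext i'
      exact and_congr_right fun h => hk i' h.le
    refine ⟨Set.ncard {i' | i' < i ∧ IsPerm one act w i'}, ?_, fun r' hr' => ?_⟩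
    · refine (hfr.and_eventually (hpos.and (Filter.eventually_ge_atTop i))).mono ?_
      rintro k ⟨hab, hp, hik⟩
      exact ⟨i, e, hi k hik, hp, hab, hacc⟩
    · filter_upwards [hev, hpos, Filter.eventually_ge_atTop i] with k h1 h2 h3
      rintro ⟨i', hr, hnr, hp⟩
      have hle : i' ≤ i := by
        by_contra hcon
        have := repPos_lt (hi k h3) (not_le.1 hcon)
        omega
      exact hnr ((h1 i' hle).1 hr _ (by omega))
  · rintro ⟨r, hgood, hlost⟩
    have hlost' := (Filter.eventually_all_finite (Set.finite_Iic r)).2 hlost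
    obtain ⟨T, hT⟩ := Filter.eventually_atTop.1 hlost'
    obtain ⟨k0, hk0, i, -, hir, hp, -⟩ := Filter.frequently_atTop.1 hgood T
    have hstay : ∀ k, k0 ≤ k → IsRep one act w k i ∧ repPos one act w k i = r := by
      intro k hk
      induction k, hk using Nat.le_induction with
      | base => exact ⟨hir, hp⟩
      | succ k hk ih =>
        have hnl : ∀ i' ≤ i, IsRep one act w k i' → IsRep one act w (k + 1) i' := by
          intro i' hi' hr
          by_contra hcon
          refine hT k (by omega) (repPos one act w k i') ?_ ⟨i', hr, hcon, rfl⟩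
          rw [Set.mem_Iic, ← ih.2]
          rcases hi'.lt_or_eq with h | h
          · exact (repPos_lt hr h).le
          · rw [h]
        refine ⟨hnl i le_rfl ih.1, ?_⟩
        rw [← ih.2]
        unfold repPos
        congr 1
        ext i'
        have := ih.1.1
        exact and_congr_right fun h => ⟨fun h' => h'.anti (by omega) (by omega), hnl i' h.le⟩
    have hfr : ∃ᶠ k in Filter.atTop, ∃ e ∈ {e | acc (runFrom one act w 0 i) e},
        RunAbsorbs one act w e i k := by
      refine (hgood.and_eventually (Filter.eventually_ge_atTop k0)).mono ?_
      rintro k ⟨⟨i', e, hr, hp', hab, hacc⟩, hk⟩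
      obtain ⟨hri, hpi⟩ := hstay k hk
      have : i' = i := by
        rcases lt_trichotomy i' i with h | h | h
        · have := repPos_lt hr h
          omega
        · exact h
        · have := repPos_lt hri h
          omega
      subst this
      exact ⟨e, hacc, hab⟩
    obtain ⟨e, he, hfr⟩ := exists_frequently_of_finite (Set.toFinite _) hfr
    obtain ⟨j, hj, rfl, hje⟩ := exists_factorization hfr
    exact (hQ j e hj hje).2 he

/-- The priority expressing that some position is eventually kept while being good infinitely
often. -/
noncomputable def rabinPriority (N : ℕ) (lost good : ℕ → Prop) : ℕ :=
  (Finset.range N).sup fun r =>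
    if lost r then 2 * (N - r) + 1 else if good r then 2 * (N - r) else 0

theorem limsupIn_rabinPriority {N : ℕ} {lost good : ℕ → ℕ → Prop}
    (hN : ∀ r k, good r k → r < N) :
    LimsupIn (fun m => Even m ∧ 0 < m)
      (fun k => rabinPriority N (fun r => lost r k) fun r => good r k) ↔
    ∃ r, (∃ᶠ k in Filter.atTop, good r k) ∧
      ∀ r' ≤ r, ∀ᶠ k in Filter.atTop, ¬ lost r' k := by
  have hle : ∀ k m, rabinPriority N (fun r => lost r k) (fun r => good r k) ≤ m ↔
      ∀ r < N, (if lost r k then 2 * (N - r) + 1 else if good r k then 2 * (N - r) else 0) ≤ m := by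
    intro k m
    simp [rabinPriority]
  have hge : ∀ k r, r < N →
      (if lost r k then 2 * (N - r) + 1 else if good r k then 2 * (N - r) else 0) ≤
      rabinPriority N (fun r => lost r k) (fun r => good r k) := fun k r hr =>
    (hle k _).1 le_rfl r hr
  constructor
  · rintro ⟨m, ⟨⟨a, ha⟩, hm0⟩, h1, h2⟩
    have hatt : ∀ k, rabinPriority N (fun r => lost r k) (fun r => good r k) ≤ m →
        m ≤ rabinPriority N (fun r => lost r k) (fun r => good r k) →
        ∃ r ∈ Finset.range N, (fun r k => good r k ∧ m = 2 * (N - r)) r k := by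
      intro k hk hk'
      have hne : (Finset.range N).Nonempty := by
        rw [Finset.nonempty_range_iff]
        rintro rfl
        simp [rabinPriority] at hk'
        omega
      obtain ⟨r, hr, he⟩ := Finset.exists_mem_eq_sup (Finset.range N) hne
        fun r => if lost r k then 2 * (N - r) + 1 else if good r k then 2 * (N - r) else 0
      refine ⟨r, hr, ?_⟩
      change rabinPriority N (fun r => lost r k) (fun r => good r k) = _ at he
      split_ifs at he with hl hg
      · omega
      · exact ⟨hg, by omega⟩
      · omega
    obtain ⟨r, hr, hfr⟩ := exists_frequently_of_finite (Finset.range N).finite_toSet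
      ((h2.and_eventually h1).mono fun k hk => hatt k hk.2 hk.1)
    obtain ⟨_, _, hmr⟩ := hfr.exists
    rw [Finset.mem_coe, Finset.mem_range] at hr
    refine ⟨r, hfr.mono fun k hk => hk.1, fun r' hr' => h1.mono fun k hk hl => ?_⟩
    have := (hge k r' (by omega)).trans hk
    rw [if_pos hl] at this
    omega
  · intro hex
    obtain ⟨hg, hl⟩ := Nat.find_spec hex
    set r := Nat.find hex with hr
    obtain ⟨k, hk⟩ := hg.exists
    have hrN := hN r k hk
    refine ⟨2 * (N - r), ⟨by simp, by omega⟩, ?_, ?_⟩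
    · have hall : ∀ᶠ k in Filter.atTop, ∀ r' ∈ Set.Iic r, ¬ lost r' k ∧ (r' < r → ¬ good r' k) := by
        refine (Filter.eventually_all_finite (Set.finite_Iic r)).2 fun r' hr' => ?_
        refine (hl r' hr').and ?_
        by_cases hlt : r' < r
        · have := Nat.find_min hex hlt
          have hnf : ¬ ∃ᶠ k in Filter.atTop, good r' k := fun hf =>
            this ⟨hf, fun r'' hr'' => hl r'' (hr''.trans hr')⟩
          exact (Filter.not_frequently.1 hnf).mono fun k hk _ => hk
        · exact Filter.Eventually.of_forall fun k h => absurd h hlt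
      refine hall.mono fun k hk => (hle k _).2 fun r' hr' => ?_
      rcases lt_trichotomy r' r with h | h | h
      · rw [if_neg (hk r' (Set.mem_Iic.2 h.le)).1, if_neg ((hk r' (Set.mem_Iic.2 h.le)).2 h)]
        omega
      · subst h
        rw [if_neg (hk _ (Set.mem_Iic.2 le_rfl)).1]
        split_ifs <;> omega
      · split_ifs <;> omega
    · refine hg.mono fun k hk => le_trans ?_ (hge k r hrN)
      split_ifs <;> omega

theorem rabinPriority_le (N : ℕ) (lost good : ℕ → Prop) :
    rabinPriority N lost good ≤ 2 * N + 1 := by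
  simp only [rabinPriority, Finset.sup_le_iff, Finset.mem_range]
  intro r hr
  split_ifs <;> omega

end Determinization

/-- The run of a deterministic automaton on a word. -/
def detRun {D L : Type} (d : D) (step : D → L → D) (w : ℕ → L) : ℕ → D
  | 0 => d
  | k + 1 => step (detRun d step w k) (w k)

/-- The finite abstraction of the collection of all runs of a deterministic automaton: the
states reached (`alive`), ordered by the age of their oldest run, the state `pre v` of the
initial run when the oldest run reaching `v` was started, and the state `mat u v` of the oldest
run reaching `u` when the one reaching `v` was started. -/
structure MergeState (M : Type) where
  alive : Set M
  lt : M → M → Prop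
  pre : M → M
  mat : M → M → M
  top : M

namespace MergeState

variable {M L : Type}

instance [Finite M] : Finite (MergeState M) :=
  Finite.of_injective (fun d : MergeState M => (d.alive, d.lt, d.pre, d.mat, d.top)) <| by
    rintro ⟨⟩ ⟨⟩ h
    simp only [Prod.mk.injEq] at h
    obtain ⟨rfl, rfl, rfl, rfl, rfl⟩ := h
    rfl

/-- `v` is the oldest state moving to `v'` on the letter `a`. -/
def IsParent (act : M → L → M) (d : MergeState M) (a : L) (v v' : M) : Prop :=
  v ∈ d.alive ∧ act v a = v' ∧ ∀ u ∈ d.alive, act u a = v' → ¬ d.lt u v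

/-- The oldest state moving to `v'` on the letter `a`. -/
noncomputable def parent (act : M → L → M) (d : MergeState M) (a : L) (v' : M) : M :=
  if h : ∃ v, IsParent act d a v v' then h.choose else v'

/-- The initial state. -/
def start (one : M) : MergeState M where
  alive := {one}
  lt _ _ := False
  pre _ := one
  mat _ _ := one
  top := one

/-- The transition function. -/
noncomputable def step (one : M) (act : M → L → M) (d : MergeState M) (a : L) :
    MergeState M where
  alive := {v' | v' = one ∨ ∃ v, IsParent act d a v v'}
  lt u' v' := u' ≠ one ∧ (v' = one ∨ d.lt (parent act d a u') (parent act d a v'))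
  pre v' := if v' = one then act d.top a else d.pre (parent act d a v')
  mat u' v' := if v' = one then u' else d.mat (parent act d a u') (parent act d a v')
  top := act d.top a

/-- The position of a state in the order of ages. -/
noncomputable def pos (d : MergeState M) (u : M) : ℕ := Set.ncard {v | v ∈ d.alive ∧ d.lt v u}

/-- The letter `a` merges the state at position `r` into an older one. -/
def Lost (act : M → L → M) (d : MergeState M) (a : L) (r : ℕ) : Prop :=
  ∃ u ∈ d.alive, ∃ v ∈ d.alive, d.lt u v ∧ act u a = act v a ∧ d.pos v = r

/-- The letter `a` merges a younger state into the state at position `r`, witnessing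
acceptance. -/
def Good (act : M → L → M) (acc : M → M → Prop) (d : MergeState M) (a : L) (r : ℕ) : Prop :=
  ∃ u ∈ d.alive, ∃ v ∈ d.alive, d.lt u v ∧ act u a = act v a ∧ d.pos u = r ∧
    acc (d.pre u) (d.mat u v)

theorem Good.lt [Finite M] {act : M → L → M} {acc : M → M → Prop} {d : MergeState M} {a : L}
    {r : ℕ} (h : d.Good act acc a r) : r < Nat.card M + 1 := by
  obtain ⟨u, -, v, -, -, -, rfl, -⟩ := h
  exact Nat.lt_succ_of_le ((Set.ncard_le_ncard (Set.subset_univ _) (Set.toFinite _)).trans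
    (Set.ncard_univ M).le)

/-- `d` describes the runs on `w` at time `k`, the oldest run reaching a state `v` being
started at time `ρ v`. -/
structure Represents (one : M) (act : M → L → M) (w : ℕ → L) (k : ℕ) (d : MergeState M)
    (ρ : M → ℕ) : Prop where
  of_isRep : ∀ i, IsRep one act w k i →
    runFrom one act w i k ∈ d.alive ∧ ρ (runFrom one act w i k) = i
  of_alive : ∀ v ∈ d.alive, IsRep one act w k (ρ v) ∧ runFrom one act w (ρ v) k = v
  lt_iff : ∀ u ∈ d.alive, ∀ v ∈ d.alive, (d.lt u v ↔ ρ u < ρ v)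
  pre_eq : ∀ v ∈ d.alive, d.pre v = runFrom one act w 0 (ρ v)
  mat_eq : ∀ u ∈ d.alive, ∀ v ∈ d.alive, ρ u < ρ v → d.mat u v = runFrom one act w (ρ u) (ρ v)
  top_eq : d.top = runFrom one act w 0 k

variable {one : M} {act : M → L → M} {w : ℕ → L} {k : ℕ} {d : MergeState M} {ρ : M → ℕ}

theorem represents_start : Represents one act w 0 (start one) (fun _ => 0) := by
  have h0 : ∀ i, runFrom one act w i 0 = one := fun i => rfl
  constructor
  · intro i hi
    exact ⟨h0 i, (Nat.le_zero.1 hi.1).symm⟩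
  · rintro v rfl
    exact ⟨⟨le_rfl, fun i' hi' => absurd hi' (Nat.not_lt_zero _)⟩, rfl⟩
  · simp [start]
  · simp [start, runFrom]
  · simp
  · rfl

theorem isRep_unique {i j : ℕ} (hi : IsRep one act w k i) (hj : IsRep one act w k j)
    (h : runFrom one act w i k = runFrom one act w j k) : i = j := by
  rcases lt_trichotomy i j with hl | hl | hl
  · exact absurd h (hj.2 i hl)
  · exact hl
  · exact absurd h.symm (hi.2 j hl)

namespace Represents

theorem isRep_of_isParent (hd : Represents one act w k d ρ) {v v' : M}
    (h : IsParent act d (w k) v v') :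
    ρ v ≤ k ∧ IsRep one act w (k + 1) (ρ v) ∧ runFrom one act w (ρ v) (k + 1) = v' := by
  obtain ⟨hv, hvv', hmin⟩ := h
  obtain ⟨hr, hrun⟩ := hd.of_alive v hv
  have hrun' : runFrom one act w (ρ v) (k + 1) = v' := by rw [runFrom_succ hr.1, hrun, hvv']
  refine ⟨hr.1, ⟨hr.1.trans k.le_succ, fun i' hi' he => ?_⟩, hrun'⟩
  have hi'k : i' ≤ k := hi'.le.trans hr.1
  obtain ⟨j, hj, hjr, hje⟩ := exists_isRep (one := one) (act := act) (w := w) hi'k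
  obtain ⟨h1, h2⟩ := hd.of_isRep j hjr
  refine hmin _ h1 ?_ ((hd.lt_iff _ h1 _ hv).2 (by omega))
  rw [hje, ← runFrom_succ (one := one) (act := act) (w := w) hi'k, he, hrun']

theorem isParent_of_isRep (hd : Represents one act w k d ρ) {i : ℕ} (hi : i ≤ k)
    (h : IsRep one act w (k + 1) i) :
    IsParent act d (w k) (runFrom one act w i k) (runFrom one act w i (k + 1)) := by
  obtain ⟨h1, h2⟩ := hd.of_isRep i (h.anti hi k.le_succ)
  refine ⟨h1, (runFrom_succ hi).symm, fun u hu hact hlt => ?_⟩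
  rw [hd.lt_iff _ hu _ h1, h2] at hlt
  obtain ⟨hr, hrun⟩ := hd.of_alive u hu
  refine h.2 _ hlt ?_
  rw [runFrom_succ hr.1, hrun, hact]

theorem step (hact : ∀ m a, act m a ≠ one) (hd : Represents one act w k d ρ) :
    Represents one act w (k + 1) (step one act d (w k))
      (fun v' => if v' = one then k + 1 else ρ (parent act d (w k) v')) := by
  have hpar : ∀ v' ∈ (MergeState.step one act d (w k)).alive, v' ≠ one →
      IsParent act d (w k) (parent act d (w k) v') v' := by
    intro v' hv' hne
    have hex : ∃ v, IsParent act d (w k) v v' := hv'.resolve_left hne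
    unfold parent
    rw [dif_pos hex]
    exact hex.choose_spec
  have hsucc : ∀ i, i ≤ k → runFrom one act w i (k + 1) ≠ one := fun i hi => by
    rw [runFrom_succ hi]; exact hact _ _
  constructor
  · intro i hi
    rcases Nat.lt_or_ge k i with hlt | hle
    · obtain rfl : i = k + 1 := le_antisymm hi.1 hlt
      rw [runFrom_self]
      exact ⟨Or.inl rfl, if_pos rfl⟩
    · have hp := hd.isParent_of_isRep hle hi
      have hal : runFrom one act w i (k + 1) ∈ (MergeState.step one act d (w k)).alive :=
        Or.inr ⟨_, hp⟩
      refine ⟨hal, ?_⟩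
      rw [if_neg (hsucc i hle)]
      obtain ⟨_, h2, h3⟩ := hd.isRep_of_isParent (hpar _ hal (hsucc i hle))
      exact isRep_unique h2 hi h3
  · intro v' hv'
    by_cases h1 : v' = one
    · subst h1
      simp only [if_true]
      exact ⟨isRep_self hact _, runFrom_self _⟩
    · simp only [if_neg h1]
      exact (hd.isRep_of_isParent (hpar v' hv' h1)).2
  · intro u' hu' v' hv'
    by_cases h1 : u' = one
    · simp only [MergeState.step, h1, ne_eq, not_true, false_and, if_true, false_iff, not_lt]
      split_ifs with h2
      · exact le_rfl
      · exact (hd.isRep_of_isParent (hpar v' hv' h2)).1.trans k.le_succ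
    · have hu := hpar u' hu' h1
      by_cases h2 : v' = one
      · simp only [MergeState.step, ne_eq, h1, not_false_iff, h2, true_or, and_self, if_false,
          if_true, true_iff]
        exact Nat.lt_succ_of_le (hd.isRep_of_isParent hu).1
      · simp only [MergeState.step, ne_eq, h1, not_false_iff, h2, false_or, true_and, if_false]
        exact hd.lt_iff _ hu.1 _ (hpar v' hv' h2).1
  · intro v' hv'
    by_cases h2 : v' = one
    · simp only [MergeState.step, h2, if_true]
      rw [hd.top_eq, runFrom_succ (Nat.zero_le k)]
    · simp only [MergeState.step, h2, if_false]
      exact hd.pre_eq _ (hpar v' hv' h2).1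
  · intro u' hu' v' hv' hlt
    by_cases h1 : u' = one
    · exfalso
      simp only [h1, if_true] at hlt
      split_ifs at hlt with h2
      · omega
      · have := (hd.isRep_of_isParent (hpar v' hv' h2)).1
        omega
    · have hu := hpar u' hu' h1
      by_cases h2 : v' = one
      · simp only [MergeState.step, h2, if_true, if_neg h1]
        exact (hd.isRep_of_isParent hu).2.2.symm
      · simp only [if_neg h1, if_neg h2] at hlt
        simp only [MergeState.step, if_neg h1, if_neg h2]
        exact hd.mat_eq _ hu.1 _ (hpar v' hv' h2).1 hlt
  · change act d.top (w k) = _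
    rw [hd.top_eq, runFrom_succ (Nat.zero_le k)]

theorem pos_eq (hd : Represents one act w k d ρ) {u : M} (hu : u ∈ d.alive) :
    d.pos u = repPos one act w k (ρ u) := by
  have himg : {i' | i' < ρ u ∧ IsRep one act w k i'} = ρ '' {v | v ∈ d.alive ∧ d.lt v u} := by
    ext i
    constructor
    · rintro ⟨h1, h2⟩
      obtain ⟨h3, h4⟩ := hd.of_isRep i h2
      exact ⟨_, ⟨h3, (hd.lt_iff _ h3 _ hu).2 (h4.symm ▸ h1)⟩, h4⟩
    · rintro ⟨v, ⟨h1, h2⟩, rfl⟩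
      exact ⟨(hd.lt_iff _ h1 _ hu).1 h2, (hd.of_alive v h1).1⟩
  unfold pos repPos
  rw [himg, Set.InjOn.ncard_image]
  intro v hv v' hv' h
  rw [← (hd.of_alive v hv.1).2, ← (hd.of_alive v' hv'.1).2, h]

theorem lost_iff (hd : Represents one act w k d ρ) (r : ℕ) :
    d.Lost act (w k) r ↔ LostAt one act w r k := by
  constructor
  · rintro ⟨u, hu, v, hv, hlt, he, rfl⟩
    obtain ⟨h1, h2⟩ := hd.of_alive v hv
    obtain ⟨h3, h4⟩ := hd.of_alive u hu
    refine ⟨ρ v, h1, fun hr => hr.2 _ ((hd.lt_iff _ hu _ hv).1 hlt) ?_, (hd.pos_eq hv).symm⟩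
    rw [runFrom_succ h3.1, runFrom_succ h1.1, h2, h4, he]
  · rintro ⟨i, h1, h2, rfl⟩
    have : ∃ i' < i, runFrom one act w i' (k + 1) = runFrom one act w i (k + 1) := by
      by_contra hcon
      push Not at hcon
      exact h2 ⟨h1.1.trans k.le_succ, hcon⟩
    obtain ⟨i', hi', he⟩ := this
    have hik : i' ≤ k := hi'.le.trans h1.1
    obtain ⟨j, hj, hjr, hje⟩ := exists_isRep (one := one) (act := act) (w := w) hik
    obtain ⟨h3, h4⟩ := hd.of_isRep i h1
    obtain ⟨h5, h6⟩ := hd.of_isRep j hjr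
    refine ⟨_, h5, _, h3, (hd.lt_iff _ h5 _ h3).2 (by omega), ?_, ?_⟩
    · rw [hje, ← runFrom_succ (one := one) (act := act) (w := w) hik,
        ← runFrom_succ (one := one) (act := act) (w := w) h1.1, he]
    · rw [hd.pos_eq h3, h4]

theorem good_iff (hd : Represents one act w k d ρ) (acc : M → M → Prop) (r : ℕ) :
    d.Good act acc (w k) r ↔ GoodAt one act acc w r k := by
  constructor
  · rintro ⟨u, hu, v, hv, hlt, he, rfl, hacc⟩
    obtain ⟨h1, h2⟩ := hd.of_alive v hv
    obtain ⟨h3, h4⟩ := hd.of_alive u hu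
    have hlt' := (hd.lt_iff _ hu _ hv).1 hlt
    refine ⟨ρ u, _, h3, (hd.pos_eq hu).symm, ⟨ρ v, hlt', h1, ?_, rfl⟩, ?_⟩
    · rw [runFrom_succ h3.1, runFrom_succ h1.1, h2, h4, he]
    · rwa [← hd.pre_eq u hu, ← hd.mat_eq u hu v hv hlt']
  · rintro ⟨i, e, h1, rfl, ⟨j, hij, hjr, he, rfl⟩, hacc⟩
    obtain ⟨h3, h4⟩ := hd.of_isRep i h1
    obtain ⟨h5, h6⟩ := hd.of_isRep j hjr
    have hlt : ρ (runFrom one act w i k) < ρ (runFrom one act w j k) := by rwa [h4, h6]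
    refine ⟨_, h3, _, h5, (hd.lt_iff _ h3 _ h5).2 hlt, ?_, ?_, ?_⟩
    · rw [← runFrom_succ (one := one) (act := act) (w := w) h1.1,
        ← runFrom_succ (one := one) (act := act) (w := w) hjr.1, he]
    · rw [hd.pos_eq h3, h4]
    · rwa [hd.pre_eq _ h3, hd.mat_eq _ h3 _ h5 hlt, h4, h6]

end Represents

theorem exists_represents (hact : ∀ m a, act m a ≠ one) (w : ℕ → L) (k : ℕ) :
    ∃ ρ, Represents one act w k (detRun (start one) (MergeState.step one act) w k) ρ := by
  induction k with
  | zero => exact ⟨_, represents_start⟩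
  | succ k ih => exact ih.elim fun ρ h => ⟨_, h.step hact⟩

end MergeState

/-- A condition on words which is determined, along every factorization `s, e, e, …` in a finite
algebra, by the pair `(s, e)`, is recognized by a deterministic parity automaton. -/
theorem exists_deterministic_parity {M L : Type} [Finite M] {one : M} {act : M → L → M}
    (hact : ∀ m a, act m a ≠ one) (acc : M → M → Prop) :
    ∃ (D : Type) (_ : Finite D) (d : D) (step : D → L → D) (prio : D → L → ℕ) (N : ℕ)
      (E : ℕ → Prop), (∀ d a, prio d a ≤ N) ∧ ∀ (w : ℕ → L) (Q : Prop),
        (∀ (j : ℕ → ℕ) (e : M), StrictMono j →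
          (∀ n, runFrom one act w (j n) (j (n + 1)) = e) →
          (Q ↔ acc (runFrom one act w 0 (j 0)) e)) →
        (Q ↔ LimsupIn E fun k => prio (detRun d step w k) (w k)) := by
  refine ⟨MergeState M, inferInstance, .start one, .step one act,
    fun d a => rabinPriority (Nat.card M + 1) (d.Lost act a) (d.Good act acc a), _,
    fun m => Even m ∧ 0 < m, fun d a => rabinPriority_le _ _ _, fun w Q hQ => ?_⟩
  rw [accepted_iff_goodAt hact hQ]
  symm
  convert limsupIn_rabinPriority (N := Nat.card M + 1) (lost := LostAt one act w)
    (good := GoodAt one act acc w) ?_ using 4 with k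
  · obtain ⟨ρ, h⟩ := MergeState.exists_represents hact w k
    exact funext fun r => propext (h.lost_iff r)
  · obtain ⟨ρ, h⟩ := MergeState.exists_represents hact w k
    exact funext fun r => propext (h.good_iff acc r)
  · intro r k hr
    obtain ⟨ρ, h⟩ := MergeState.exists_represents hact w k
    exact ((h.good_iff acc r).2 hr).lt

theorem StrictMono.exists_block {j : ℕ → ℕ} (hj : StrictMono j) {l : ℕ} (hl : j 0 ≤ l) :
    ∃ n, j n ≤ l ∧ l < j (n + 1) := by
  have hex : ∃ n, l < j (n + 1) := ⟨l, hj.le_apply.trans_lt (hj l.lt_succ_self)⟩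
  refine ⟨Nat.find hex, ?_, Nat.find_spec hex⟩
  rcases h : Nat.find hex with _ | n
  · exact hl
  · exact not_lt.1 (Nat.find_min hex (h ▸ n.lt_succ_self))

theorem StrictMono.block_unique {j : ℕ → ℕ} (hj : StrictMono j) {l n m : ℕ} (h1 : j n ≤ l)
    (h2 : l < j (n + 1)) (h3 : j m ≤ l) (h4 : l < j (m + 1)) : n = m := by
  have := hj.lt_iff_lt.1 (h1.trans_lt h4)
  have := hj.lt_iff_lt.1 (h3.trans_lt h2)
  omega

theorem limsupIn_blocks {E : ℕ → Prop} {j x c : ℕ → ℕ} (hj : StrictMono j)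
    (hle : ∀ n l, j n ≤ l → l < j (n + 1) → x l ≤ c n)
    (heq : ∀ n, ∃ l, j n ≤ l ∧ l < j (n + 1) ∧ x l = c n) : LimsupIn E x ↔ LimsupIn E c := by
  have hn : ∀ n, n ≤ j n := fun n => hj.le_apply
  have hblock : ∀ N l, j N ≤ l → ∃ n, N ≤ n ∧ x l ≤ c n := by
    intro N l hl
    obtain ⟨n, h1, h2⟩ := hj.exists_block ((hj.monotone N.zero_le).trans hl)
    exact ⟨n, Nat.le_of_lt_succ (hj.lt_iff_lt.1 (hl.trans_lt h2)), hle n l h1 h2⟩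
  refine exists_congr fun m => and_congr_right fun _ => and_congr ?_ ?_
  · simp only [Filter.eventually_atTop]
    constructor
    · rintro ⟨N, hN⟩
      refine ⟨N, fun n hNn => ?_⟩
      obtain ⟨l, h1, -, h3⟩ := heq n
      exact h3 ▸ hN l ((hNn.trans (hn n)).trans h1)
    · rintro ⟨N, hN⟩
      refine ⟨j N, fun l hl => ?_⟩
      obtain ⟨n, h1, h2⟩ := hblock N l hl
      exact h2.trans (hN n h1)
  · simp only [Filter.frequently_atTop]
    constructor
    · intro h N
      obtain ⟨l, hl, hm⟩ := h (j N)
      obtain ⟨n, h1, h2⟩ := hblock N l hl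
      exact ⟨n, h1, hm.trans h2⟩
    · intro h N
      obtain ⟨n, hNn, hm⟩ := h N
      obtain ⟨l, h1, -, h3⟩ := heq n
      exact ⟨l, (hNn.trans (hn n)).trans h1, h3 ▸ hm⟩

section Traces

variable {A : Type}

/-- Composition of a set of path profiles `(start, state of maximal priority, end)` with a
relation. -/
def profileAct (Ω : A → ℕ) : Option (Set (A × A × A)) → Set (A × A) →
    Option (Set (A × A × A))
  | none, R => some {t | t.2.1 = t.1 ∧ (t.1, t.2.2) ∈ R}
  | some X, R => some {t | ∃ c b, (t.1, c, b) ∈ X ∧ (b, t.2.2) ∈ R ∧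
      (t.2.1 = c ∧ Ω b ≤ Ω c ∨ t.2.1 = b ∧ Ω c ≤ Ω b)}

/-- `x` is a path through the relations `w` from time `i` to time `k`. -/
def IsPath (w : ℕ → Set (A × A)) (i k : ℕ) (x : ℕ → A) : Prop :=
  ∀ l, i ≤ l → l < k → (x l, x (l + 1)) ∈ w l

/-- `c` is a state of maximal priority among the `x l` with `i ≤ l < k`. -/
def IsMaxState (Ω : A → ℕ) (i k : ℕ) (x : ℕ → A) (c : A) : Prop :=
  (∃ l, i ≤ l ∧ l < k ∧ x l = c) ∧ ∀ l, i ≤ l → l < k → Ω (x l) ≤ Ω c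

theorem exists_profile (Ω : A → ℕ) (w : ℕ → Set (A × A)) {i k : ℕ} (h : i < k) :
    ∃ X, runFrom none (profileAct Ω) w i k = some X ∧ ∀ a c b, (a, c, b) ∈ X ↔
      ∃ x : ℕ → A, IsPath w i k x ∧ x i = a ∧ x k = b ∧ IsMaxState Ω i k x c := by
  induction k, h using Nat.le_induction with
  | base =>
    rw [Nat.succ_eq_add_one, runFrom_succ le_rfl, runFrom_self]
    refine ⟨_, rfl, fun a c b => ?_⟩
    constructor
    · rintro ⟨hc, h⟩
      dsimp only at hc h
      subst hc
      refine ⟨fun l => if l = i then c else b, fun l h1 h2 => ?_, by simp, by simp,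
        ⟨i, le_rfl, by omega, by simp⟩, fun l h1 h2 => ?_⟩ <;>
      · obtain rfl : l = i := by omega
        simp [h]
    · rintro ⟨x, h1, rfl, rfl, ⟨l, h2, h3, rfl⟩, -⟩
      obtain rfl : l = i := by omega
      exact ⟨rfl, h1 l le_rfl (by omega)⟩
  | succ k hk ih =>
    obtain ⟨X, hX, hmem⟩ := ih
    rw [runFrom_succ (by omega), hX]
    refine ⟨_, rfl, fun a c' b' => ?_⟩
    simp only [Set.mem_ofPred_eq, hmem]
    constructor
    · rintro ⟨c, b, ⟨x, hx, rfl, rfl, ⟨l, hl1, hl2, hl3⟩, hmax⟩, hR, hc⟩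
      refine ⟨fun l => if l ≤ k then x l else b', fun l h1 h2 => ?_, by simp; omega, by simp,
        ?_, fun l h1 h2 => ?_⟩
      · rcases (Nat.le_of_lt_succ h2).lt_or_eq with h | rfl
        · simpa [h, h.le, Nat.succ_le_of_lt h] using hx l h1 h
        · simpa using hR
      · rcases hc with ⟨rfl, -⟩ | ⟨rfl, -⟩
        · exact ⟨l, hl1, by omega, by simp [hl2.le, hl3]⟩
        · exact ⟨k, by omega, by omega, by simp⟩
      · simp only [Nat.le_of_lt_succ h2, if_true]
        rcases (Nat.le_of_lt_succ h2).lt_or_eq with h | rfl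
        · have := hmax l h1 h
          rcases hc with ⟨rfl, h⟩ | ⟨rfl, h⟩ <;> omega
        · rcases hc with ⟨rfl, h⟩ | ⟨rfl, h⟩ <;> omega
    · rintro ⟨x, hx, rfl, rfl, ⟨l, hl1, hl2, rfl⟩, hmax⟩
      obtain ⟨l', hl', hmax'⟩ := Finset.exists_max_image (Finset.Ico i k) (fun l => Ω (x l))
        ⟨i, by simp; omega⟩
      rw [Finset.mem_Ico] at hl'
      have hmax'' : ∀ m, i ≤ m → m < k → Ω (x m) ≤ Ω (x l') := fun m h1 h2 =>
        hmax' m (Finset.mem_Ico.2 ⟨h1, h2⟩)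
      have hkl := hmax k (by omega) (by omega)
      rcases (Nat.le_of_lt_succ hl2).lt_or_eq with h | rfl
      · exact ⟨x l, x k, ⟨x, fun m h1 h2 => hx m h1 (by omega), rfl, rfl, ⟨l, hl1, h, rfl⟩,
          fun m h1 h2 => hmax m h1 (by omega)⟩, hx k (by omega) (by omega), Or.inl ⟨rfl, hkl⟩⟩
      · exact ⟨x l', x l, ⟨x, fun m h1 h2 => hx m h1 (by omega), rfl, rfl,
          ⟨l', hl'.1, hl'.2, rfl⟩, hmax''⟩, hx l (by omega) (by omega),
          Or.inr ⟨rfl, hmax l' hl'.1 (by omega)⟩⟩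

/-- Every infinite path with the block profiles `s, e, e, …` satisfies the parity condition. -/
def ProfileAccepts (Ω : A → ℕ) (E : ℕ → Prop) (a : A) (s e : Option (Set (A × A × A))) : Prop :=
  ∀ y c : ℕ → A, (s = none → y 0 = a) → (∀ S, s = some S → ∃ b, (a, b, y 0) ∈ S) →
    (∀ n, ∃ X, e = some X ∧ (y n, c n, y (n + 1)) ∈ X) → LimsupIn E fun n => Ω (c n)

theorem exists_glue {α : Type} {j : ℕ → ℕ} (hj : StrictMono j) (x : ℕ → α) (p : ℕ → ℕ → α)
    (h0 : x (j 0) = p 0 (j 0)) (hp : ∀ n, p n (j (n + 1)) = p (n + 1) (j (n + 1))) :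
    ∃ z : ℕ → α, (∀ l ≤ j 0, z l = x l) ∧ ∀ n l, j n ≤ l → l ≤ j (n + 1) → z l = p n l := by
  have hblock : ∀ l, ∃ n, j 0 ≤ l → j n ≤ l ∧ l < j (n + 1) := fun l => by
    by_cases hl : j 0 ≤ l
    · exact (hj.exists_block hl).imp fun n h _ => h
    · exact ⟨0, fun h => absurd h hl⟩
  choose n hn using hblock
  have hmain : ∀ m l, j m ≤ l → l < j (m + 1) → n l = m := fun m l h1 h2 => by
    obtain ⟨h3, h4⟩ := hn l ((hj.monotone m.zero_le).trans h1)
    exact hj.block_unique h3 h4 h1 h2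
  refine ⟨fun l => if l < j 0 then x l else p (n l) l, fun l hl => ?_, fun m l h1 h2 => ?_⟩
  · rcases hl.lt_or_eq with h | rfl
    · simp [h]
    · simp [hmain 0 (j 0) le_rfl (hj Nat.zero_lt_one), h0]
  · have : ¬ l < j 0 := not_lt.2 ((hj.monotone m.zero_le).trans h1)
    simp only [this, if_false]
    rcases h2.lt_or_eq with h | rfl
    · rw [hmain m l h1 h]
    · rw [hmain (m + 1) _ le_rfl (hj (Nat.lt_succ_self _)), hp]

theorem forall_path_iff_profileAccepts (Ω : A → ℕ) (E : ℕ → Prop) (a : A)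
    (w : ℕ → Set (A × A)) (j : ℕ → ℕ) (e : Option (Set (A × A × A))) (hj : StrictMono j)
    (he : ∀ n, runFrom none (profileAct Ω) w (j n) (j (n + 1)) = e) :
    (∀ x : ℕ → A, x 0 = a → (∀ i, (x i, x (i + 1)) ∈ w i) → LimsupIn E fun i => Ω (x i)) ↔
      ProfileAccepts Ω E a (runFrom none (profileAct Ω) w 0 (j 0)) e := by
  have hlt : ∀ n, j n < j (n + 1) := fun n => hj n.lt_succ_self
  constructor
  · intro hQ y c hs0 hs hy
    have hblk : ∀ n, ∃ x : ℕ → A, IsPath w (j n) (j (n + 1)) x ∧ x (j n) = y n ∧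
        x (j (n + 1)) = y (n + 1) ∧ IsMaxState Ω (j n) (j (n + 1)) x (c n) := by
      intro n
      obtain ⟨X, hX, hmem⟩ := hy n
      obtain ⟨X', hX', hmem'⟩ := exists_profile Ω w (hlt n)
      obtain rfl : X = X' := Option.some_injective _ (by rw [← hX, ← hX', he])
      exact (hmem' _ _ _).1 hmem
    choose p hpath hstart hend hmax using hblk
    have hinit : ∃ x : ℕ → A, IsPath w 0 (j 0) x ∧ x 0 = a ∧ x (j 0) = y 0 := by
      rcases Nat.eq_zero_or_pos (j 0) with h | h
      · rw [h]
        refine ⟨fun _ => a, fun l _ h2 => absurd h2 (Nat.not_lt_zero _), rfl, (hs0 ?_).symm⟩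
        rw [h]
        rfl
      · obtain ⟨X, hX, hmem⟩ := exists_profile Ω w h
        obtain ⟨b, hb⟩ := hs X hX
        obtain ⟨x, h1, h2, h3, -⟩ := (hmem _ _ _).1 hb
        exact ⟨x, h1, h2, h3⟩
    obtain ⟨x, hx, hx0, hxj⟩ := hinit
    obtain ⟨z, hz0, hz⟩ := exists_glue hj x p (hxj.trans (hstart 0).symm)
      fun n => (hend n).trans (hstart (n + 1)).symm
    rw [← limsupIn_blocks (x := fun i => Ω (z i)) hj ?_ ?_]
    · refine hQ z ((hz0 0 (Nat.zero_le _)).trans hx0) fun i => ?_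
      rcases Nat.lt_or_ge i (j 0) with h | h
      · rw [hz0 i h.le, hz0 (i + 1) h]
        exact hx i (Nat.zero_le _) h
      · obtain ⟨n, h1, h2⟩ := hj.exists_block h
        rw [hz n i h1 h2.le, hz n (i + 1) (by omega) h2]
        exact hpath n i h1 h2
    · intro n l h1 h2
      rw [hz n l h1 h2.le]
      exact (hmax n).2 l h1 h2
    · intro n
      obtain ⟨l, h1, h2, h3⟩ := (hmax n).1
      exact ⟨l, h1, h2, by rw [hz n l h1 h2.le, h3]⟩
  · intro hacc x hx0 hx
    have hc : ∀ n, ∃ c, IsMaxState Ω (j n) (j (n + 1)) x c := by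
      intro n
      obtain ⟨l, hl, hmax⟩ := Finset.exists_max_image (Finset.Ico (j n) (j (n + 1)))
        (fun l => Ω (x l)) ⟨j n, Finset.mem_Ico.2 ⟨le_rfl, hlt n⟩⟩
      rw [Finset.mem_Ico] at hl
      exact ⟨x l, ⟨l, hl.1, hl.2, rfl⟩, fun m h1 h2 => hmax m (Finset.mem_Ico.2 ⟨h1, h2⟩)⟩
    choose c hc using hc
    rw [limsupIn_blocks (x := fun i => Ω (x i)) (c := fun n => Ω (c n)) hj
      (fun n l h1 h2 => (hc n).2 l h1 h2)
          fun n => (hc n).1.imp fun l h => ⟨h.1, h.2.1, by rw [h.2.2]⟩]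
    refine hacc (fun n => x (j n)) c (fun h => ?_) (fun S hS => ?_) fun n => ?_
    · rcases Nat.eq_zero_or_pos (j 0) with h0 | h0
      · simp only [h0, hx0]
      · obtain ⟨X, hX, -⟩ := exists_profile Ω w h0
        rw [hX] at h
        cases h
    · rcases Nat.eq_zero_or_pos (j 0) with h0 | h0
      · rw [h0] at hS
        cases hS
      · obtain ⟨X, hX, hmem⟩ := exists_profile Ω w h0
        obtain rfl : X = S := Option.some_injective _ (by rw [← hX, hS])
        obtain ⟨l, hl, hmax⟩ := Finset.exists_max_image (Finset.range (j 0))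
          (fun l => Ω (x l)) ⟨0, Finset.mem_range.2 h0⟩
        exact ⟨x l, (hmem _ _ _).2 ⟨x, fun m _ _ => hx m, hx0, rfl,
          ⟨l, Nat.zero_le _, Finset.mem_range.1 hl, rfl⟩,
          fun m _ h2 => hmax m (Finset.mem_range.2 h2)⟩⟩
    · obtain ⟨X, hX, hmem⟩ := exists_profile Ω w (hlt n)
      exact ⟨X, by rw [← hX, he], (hmem _ _ _).2 ⟨x, fun m _ _ => hx m, rfl, rfl, hc n⟩⟩

/-- The words of relations all of whose infinite paths satisfy a parity condition are recognized
by a deterministic parity automaton. -/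
theorem exists_deterministic_trace_parity [Finite A] (Ω : A → ℕ) (E : ℕ → Prop) (a : A) :
    ∃ (D : Type) (_ : Finite D) (d : D) (step : D → Set (A × A) → D)
      (prio : D → Set (A × A) → ℕ) (N : ℕ) (E' : ℕ → Prop), (∀ d R, prio d R ≤ N) ∧
        ∀ R : ℕ → Set (A × A),
          (∀ x : ℕ → A, x 0 = a → (∀ i, (x i, x (i + 1)) ∈ R i) → LimsupIn E fun i => Ω (x i)) ↔
            LimsupIn E' fun k => prio (detRun d step R k) (R k) := by
  obtain ⟨D, hD, d, step, prio, N, E', hN, h⟩ := exists_deterministic_parity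
    (one := none) (act := profileAct Ω) (fun m R => by cases m <;> simp [profileAct])
    (ProfileAccepts Ω E a)
  exact ⟨D, hD, d, step, prio, N, E', hN, fun R => h R _ fun j e hj he =>
    forall_path_iff_profileAccepts Ω E a R j e hj he⟩

end Traces

/-- A property of one-step models over `A`. -/
abbrev OneStep (T : SetFunctor) (A : Type) : Type 1 :=
  ∀ X : Type, T.obj X → (A → Set X) → Prop

/-- Definability of a property of one-step models in the one-step second-order language. -/
inductive SODef {T : SetFunctor} (F : LiftingFamily T) : (A : Type) → OneStep T A → Prop
  | subset {A : Type} (a b : A) : SODef F A fun _ _ V => V a ⊆ V b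
  | lift {A : Type} (i : F.ι) (v : Fin (F.ar i) → A) :
      SODef F A fun X α V => α ∈ (F.lf i).app X fun k => V (v k)
  | neg {A : Type} {G : OneStep T A} : SODef F A G → SODef F A fun X α V => ¬ G X α V
  | or {A : Type} {G H : OneStep T A} : SODef F A G → SODef F A H →
      SODef F A fun X α V => G X α V ∨ H X α V
  | ex {A : Type} {G : OneStep T (Option A)} : SODef F (Option A) G →
      SODef F A fun X α V => ∃ Z : Set X, G X α fun o => o.elim Z V

namespace SODef

variable {T : SetFunctor} {F : LiftingFamily T} {A B : Type}

theorem congr {G H : OneStep T A} (h : SODef F A G) (e : ∀ X α V, G X α V ↔ H X α V) :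
    SODef F A H := by
  obtain rfl : G = H := by
    funext X α V
    exact propext (e X α V)
  exact h

theorem rename {G : OneStep T A} (h : SODef F A G) (ρ : A → B) :
    SODef F B fun X α V => G X α fun a => V (ρ a) := by
  induction h generalizing B with
  | subset a b => exact subset (ρ a) (ρ b)
  | lift i v => exact lift i fun k => ρ (v k)
  | neg _ ih => exact (ih ρ).neg
  | or _ _ ih₁ ih₂ => exact (ih₁ ρ).or (ih₂ ρ)
  | @ex A G _ ih =>
    refine (ih (Option.map ρ)).ex.congr fun X α V => exists_congr fun Z => ?_
    have : (fun a => Option.elim (Option.map ρ a) Z V) =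
        fun o => Option.elim o Z fun a => V (ρ a) := by
      funext o
      cases o <;> rfl
    rw [this]

theorem and {G H : OneStep T A} (hG : SODef F A G) (hH : SODef F A H) :
    SODef F A fun X α V => G X α V ∧ H X α V :=
  (hG.neg.or hH.neg).neg.congr fun X α V => by tauto

theorem imp {G H : OneStep T A} (hG : SODef F A G) (hH : SODef F A H) :
    SODef F A fun X α V => G X α V → H X α V :=
  (hG.neg.or hH).congr fun X α V => by tauto

theorem all {G : OneStep T (Option A)} (h : SODef F (Option A) G) :
    SODef F A fun X α V => ∀ Z : Set X, G X α fun o => o.elim Z V :=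
  h.neg.ex.neg.congr fun X α V => by push Not; rfl

theorem const (p : Prop) : SODef F A fun _ _ _ => p := by
  have htrue : SODef F A fun _ _ _ => True :=
    (all (subset none none)).congr fun X α V => by simp
  by_cases hp : p
  · exact htrue.congr fun _ _ _ => by simp [hp]
  · exact htrue.neg.congr fun _ _ _ => by simp [hp]

theorem forall_finite {I : Type} [Finite I] {G : I → OneStep T A} (h : ∀ i, SODef F A (G i)) :
    SODef F A fun X α V => ∀ i, G i X α V := by
  induction I using Finite.induction_empty_option with
  | of_equiv e ih =>
    exact (ih fun i => h (e i)).congr fun X α V =>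
      e.forall_congr_right (q := fun i => G i X α V)
  | h_empty => exact (const True).congr fun X α V => by simp
  | h_option ih =>
    refine ((h none).and (ih fun i => h (some i))).congr fun X α V => ?_
    rw [Option.forall]

theorem exists_family [Finite B] {G : OneStep T (A ⊕ B)} (h : SODef F (A ⊕ B) G) :
    SODef F A fun X α V => ∃ Z : B → Set X, G X α (Sum.elim V Z) := by
  induction B using Finite.induction_empty_option generalizing A with
  | @of_equiv B C e ih =>
    refine (ih (h.rename (Sum.map id e.symm))).congr fun X α V => ?_
    refine (e.arrowCongr (Equiv.refl (Set X))).exists_congr fun Z => iff_of_eq ?_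
    congr 1
    funext x
    rcases x with a | b <;> simp
  | h_empty =>
    refine (h.rename (Sum.elim id PEmpty.elim)).congr fun X α V => ?_
    have he : ∀ Z : PEmpty → Set X,
        (fun a => V (Sum.elim id PEmpty.elim a)) = Sum.elim V Z := fun Z => by
      funext x
      rcases x with a | b
      · rfl
      · exact b.elim
    exact ⟨fun hV => ⟨PEmpty.elim, he PEmpty.elim ▸ hV⟩, fun ⟨Z, hZ⟩ => (he Z).symm ▸ hZ⟩
  | @h_option B _ ih =>
    let ρ : A ⊕ Option B → Option A ⊕ B :=
      Sum.elim (fun a => Sum.inl (some a)) fun o => o.elim (Sum.inl none) Sum.inr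
    refine (ih (A := Option A) (h.rename ρ)).ex.congr fun X α V => ?_
    constructor
    · rintro ⟨Z₀, Z, hZ⟩
      refine ⟨fun o => o.elim Z₀ Z, ?_⟩
      convert hZ using 1
      funext x
      rcases x with a | _ | b <;> rfl
    · rintro ⟨Z, hZ⟩
      refine ⟨Z none, fun b => Z (some b), ?_⟩
      convert hZ using 1
      funext x
      rcases x with a | _ | b <;> rfl

theorem univ_subset (a : A) : SODef F A fun X _ V => ∀ x : X, x ∈ V a :=
  (all (subset none (some a))).congr fun _ _ _ =>
    ⟨fun h x => h Set.univ (Set.mem_univ x), fun h _ x _ => h x⟩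

theorem disjoint (a b : A) : SODef F A fun _ _ V => ∀ x ∈ V a, x ∉ V b := by
  refine (all (imp (and (subset none (some a)) (subset none (some b)))
    (all (subset (some none) none)))).congr fun X α V => ?_
  constructor
  · exact fun h x hx hx' => h {x} ⟨by simpa using hx, by simpa using hx'⟩ ∅ rfl
  · exact fun h Z ⟨h1, h2⟩ W x hx => absurd (h2 hx) (h x (h1 hx))

end SODef

namespace SOForm

variable {T : SetFunctor} {F : LiftingFamily T} {W W' : Type}

/-- Renaming the variables of a formula. -/
def rename (f : W → W') : SOForm F W → SOForm F W'
  | .subset a b => .subset (f a) (f b)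
  | .lift i v => .lift i fun k => f (v k)
  | .neg φ => .neg (φ.rename f)
  | .or φ ψ => .or (φ.rename f) (ψ.rename f)
  | .ex w φ => .ex (f w) (φ.rename f)

theorem sat_rename {f : W → W'} (hf : Function.Injective f) (φ : SOForm F W) (X : Type)
    (α : T.obj X) (V : W' → Set X) :
    (φ.rename f).sat X α V ↔ φ.sat X α fun w => V (f w) := by
  induction φ generalizing V with
  | subset a b => rfl
  | lift i v => rfl
  | neg φ ih => exact not_congr (ih V)
  | or φ ψ ih₁ ih₂ => exact or_congr (ih₁ V) (ih₂ V)
  | ex w φ ih =>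
    refine exists_congr fun Z => (ih _).trans (iff_of_eq ?_)
    congr 1
    funext w'
    simp [updW, hf.eq_iff]

theorem fv_rename {f : W → W'} (hf : Function.Injective f) (φ : SOForm F W) :
    (φ.rename f).fv = f '' φ.fv := by
  induction φ with
  | subset a b => simp [rename, fv, Set.image_pair]
  | lift i v => exact Set.range_comp f v
  | neg φ ih => exact ih
  | or φ ψ ih₁ ih₂ => simp [rename, fv, ih₁, ih₂, Set.image_union]
  | ex w φ ih => simp [rename, fv, ih, Set.image_sdiff hf]

end SOForm

theorem SODef.exists_sentence {T : SetFunctor} {F : LiftingFamily T} {A : Type}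
    {G : OneStep T A} (h : SODef F A G) :
    ∃ φ : SOForm F (A ⊕ ℕ), IsSentence φ ∧ ∀ X α V, φ.sat0 X α V ↔ G X α V := by
  induction h with
  | subset a b =>
    refine ⟨.subset (.inl a) (.inl b), ?_, fun X α V => Iff.rfl⟩
    rintro w (rfl | rfl)
    exacts [⟨a, rfl⟩, ⟨b, rfl⟩]
  | lift i v =>
    refine ⟨.lift i fun k => .inl (v k), ?_, fun X α V => Iff.rfl⟩
    rintro w ⟨k, rfl⟩
    exact ⟨v k, rfl⟩
  | neg _ ih =>
    obtain ⟨φ, h1, h2⟩ := ih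
    exact ⟨.neg φ, h1, fun X α V => not_congr (h2 X α V)⟩
  | or _ _ ih₁ ih₂ =>
    obtain ⟨φ, h1, h2⟩ := ih₁
    obtain ⟨ψ, h3, h4⟩ := ih₂
    exact ⟨.or φ ψ, fun w hw => hw.elim (h1 w) (h3 w),
      fun X α V => or_congr (h2 X α V) (h4 X α V)⟩
  | @ex A G _ ih =>
    obtain ⟨φ, h1, h2⟩ := ih
    let f : Option A ⊕ ℕ → A ⊕ ℕ :=
      Sum.elim (fun o => o.elim (.inr 0) .inl) fun n => .inr (n + 1)
    have hf : Function.Injective f := by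
      rintro ((_ | a) | n) ((_ | b) | m) <;> simp [f]
    refine ⟨.ex (.inr 0) (φ.rename f), ?_, fun X α V => exists_congr fun Z => ?_⟩
    · rintro w ⟨hw, hne⟩
      rw [SOForm.fv_rename hf] at hw
      obtain ⟨u, hu, rfl⟩ := hw
      obtain ⟨_ | a, rfl⟩ := h1 u hu
      · exact absurd rfl hne
      · exact ⟨a, rfl⟩
    · rw [SOForm.sat_rename hf, ← h2]
      refine iff_of_eq ?_
      unfold SOForm.sat0
      congr 1
      funext w
      rcases w with (_ | a) | n <;> simp [updW, f]

theorem SODef.comp_compl {T : SetFunctor} {F : LiftingFamily T} {A : Type} [Finite A]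
    {G : OneStep T A} (h : SODef F A G) : SODef F A fun X α V => G X α fun a => (V a)ᶜ := by
  refine (exists_family (B := A) (((forall_finite fun a : A => disjoint (.inr a) (.inl a)).and
    (forall_finite fun a : A => all (imp (disjoint none (some (.inr a)))
      (subset none (some (.inl a)))))).and (h.rename Sum.inr))).congr fun X α V => ?_
  constructor
  · rintro ⟨Z, ⟨h1, h2⟩, hG⟩
    have : Z = fun a => (V a)ᶜ := by
      funext a
      ext x
      refine ⟨fun hx => h1 a x hx, fun hx => ?_⟩
      by_contra hz
      exact hx (h2 a {x} (by simpa using hz) rfl)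
    exact this ▸ hG
  · intro hG
    refine ⟨fun a => (V a)ᶜ, ⟨fun a x hx => hx, fun a W hW x hx => ?_⟩, hG⟩
    exact not_not.1 (hW x hx)

/-- A coalgebra whose successor structures are presented with names `C s` for the successors of
`s`. -/
structure Frame (T : SetFunctor) where
  S : Type
  C : S → Type
  α : (s : S) → T.obj (C s)
  e : (s : S) → C s → S

/-- The underlying coalgebra structure. -/
def Frame.σ {T : SetFunctor} (fr : Frame T) (s : fr.S) : T.obj fr.S := T.map (fr.e s) (fr.α s)

/-- A frame in which every state is reached from the root in a unique way. -/
structure Frame.IsTree {T : SetFunctor} (fr : Frame T) (r : fr.S) : Prop where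
  exists_rec : ∀ (B : Type) (b : B) (f : (s : fr.S) → B → fr.C s → B),
    ∃ g : fr.S → B, g r = b ∧ ∀ s c, g (fr.e s c) = f s (g s) c
  ind : ∀ P : fr.S → Prop, P r → (∀ s c, P s → P (fr.e s c)) → ∀ s, P s
  root_ne : ∀ s c, fr.e s c ≠ r

/-- Parity automata on frames whose transitions are definable in the one-step second-order
language. The colour of a state is the set of variables true there. -/
structure Aut {T : SetFunctor} (F : LiftingFamily T) where
  A : Type
  finite : Finite A
  start : A
  Ω : A → ℕ
  E : ℕ → Prop
  δ : A → Set ℕ → OneStep T A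
  bound : ℕ
  mono : ∀ a c X α (V V' : A → Set X), (∀ b, V b ⊆ V' b) → δ a c X α V → δ a c X α V'
  sodef : ∀ a c, SODef F A (δ a c)
  congr : ∀ a c c', (∀ q < bound, q ∈ c ↔ q ∈ c') → δ a c = δ a c'

attribute [instance] Aut.finite

namespace Aut

variable {T : SetFunctor} {F : LiftingFamily T} {fr : Frame T}

/-- The operator of the acceptance game. -/
def op (𝔸 : Aut F) (fr : Frame T) (V : ℕ → Set fr.S) (Y : Set (𝔸.A × fr.S)) :
    Set (𝔸.A × fr.S) :=
  {p | 𝔸.δ p.1 {q | p.2 ∈ V q} (fr.C p.2) (fr.α p.2) fun b => {c | (b, fr.e p.2 c) ∈ Y}}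

theorem op_mono (𝔸 : Aut F) (fr : Frame T) (V : ℕ → Set fr.S) : Monotone (𝔸.op fr V) :=
  fun _ _ h _ hp => 𝔸.mono _ _ _ _ _ _ (fun _ _ hc => h hc) hp

/-- The winning region of the acceptance game. -/
def win (𝔸 : Aut F) (fr : Frame T) (V : ℕ → Set fr.S) : Set (𝔸.A × fr.S) :=
  Win 𝔸.E (fun p => 𝔸.Ω p.1) (𝔸.op fr V)

theorem exists_lt (𝔸 : Aut F) : ∃ n, ∀ a, 𝔸.Ω a < n := by
  obtain ⟨n, hn⟩ := (Set.finite_range 𝔸.Ω).bddAbove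
  exact ⟨n + 1, fun a => Nat.lt_succ_of_le (hn ⟨a, rfl⟩)⟩

theorem op_win (𝔸 : Aut F) (fr : Frame T) (V : ℕ → Set fr.S) :
    𝔸.op fr V (𝔸.win fr V) = 𝔸.win fr V :=
  win_fixpoint (𝔸.op_mono fr V)

theorem mem_win_iff_of_true {𝔸 : Aut F} (h : 𝔸.E = fun _ => True) {V : ℕ → Set fr.S}
    {p : 𝔸.A × fr.S} : p ∈ 𝔸.win fr V ↔ ∃ D, p ∈ D ∧ D ⊆ 𝔸.op fr V D := by
  constructor
  · exact fun hp => ⟨_, hp, (𝔸.op_win fr V).symm.subset⟩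
  · rintro ⟨D, hp, hD⟩
    obtain ⟨n, hn⟩ := 𝔸.exists_lt
    unfold win
    rw [h]
    exact win_true_of_postfixed (fun p => (hn p.1).le) hD hp

/-- The automaton accepts the same trees as the formula. -/
def Recognizes (𝔸 : Aut F) (φ : MSOForm F) : Prop :=
  ∀ (fr : Frame T) (r : fr.S), fr.IsTree r → ∀ V : ℕ → Set fr.S,
    φ.sat fr.σ V r ↔ (𝔸.start, r) ∈ 𝔸.win fr V

/-- The automaton accepting nothing. -/
def bot (F : LiftingFamily T) : Aut F where
  A := Unit
  finite := inferInstance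
  start := ()
  Ω _ := 0
  E _ := True
  δ _ _ _ _ _ := False
  bound := 0
  mono _ _ _ _ _ _ _ h := h
  sodef _ _ := .const False
  congr _ _ _ _ := rfl

theorem bot_recognizes : (bot F).Recognizes .bot := by
  intro fr r _ V
  rw [mem_win_iff_of_true rfl]
  exact ⟨False.elim, fun ⟨D, h1, h2⟩ => h2 h1⟩

/-- The automaton checking that `p` is true exactly at the root. -/
def sr (F : LiftingFamily T) (p : ℕ) : Aut F where
  A := Bool
  finite := inferInstance
  start := true
  Ω _ := 0
  E _ := True
  δ a c X _ V := (a = true ↔ p ∈ c) ∧ ∀ x : X, x ∈ V false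
  bound := p + 1
  mono _ _ _ _ _ _ hV h := ⟨h.1, fun x => hV _ (h.2 x)⟩
  sodef a c := (SODef.const _).and (.univ_subset false)
  congr a c c' h := by simp only [h p p.lt_succ_self]

theorem sr_recognizes (p : ℕ) : (sr F p).Recognizes (.sr p) := by
  intro fr r hr V
  rw [mem_win_iff_of_true rfl]
  constructor
  · intro (h : V p = {r})
    refine ⟨{t | t.1 = true ↔ t.2 = r}, iff_of_true rfl rfl, ?_⟩
    rintro ⟨a, s⟩ ht
    refine ⟨?_, fun c => iff_of_false Bool.false_ne_true (hr.root_ne s c)⟩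
    change a = true ↔ s ∈ V p
    rw [h]
    exact ht
  · rintro ⟨D, h0, hD⟩
    have hall : ∀ s, s ≠ r → (false, s) ∈ D := by
      have := hr.ind (fun s => s = r ∨ (false, s) ∈ D) (Or.inl rfl) fun s c hs => Or.inr <| by
        rcases hs with rfl | hs
        · exact (hD h0).2 c
        · exact (hD hs).2 c
      exact fun s hs => (this s).resolve_left hs
    change V p = {r}
    ext s
    rw [Set.mem_singleton_iff]
    by_cases hs : s = r
    · subst hs
      exact iff_of_true ((hD h0).1.1 rfl) rfl
    · exact iff_of_false (fun h => Bool.false_ne_true ((hD (hall s hs)).1.2 h)) hs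

/-- The automaton checking that `p` is included in `q`. -/
def subset (F : LiftingFamily T) (p q : ℕ) : Aut F where
  A := Unit
  finite := inferInstance
  start := ()
  Ω _ := 0
  E _ := True
  δ _ c X _ V := (p ∈ c → q ∈ c) ∧ ∀ x : X, x ∈ V ()
  bound := max p q + 1
  mono _ _ _ _ _ _ hV h := ⟨h.1, fun x => hV _ (h.2 x)⟩
  sodef a c := (SODef.const _).and (.univ_subset ())
  congr a c c' h := by
    simp only [h p (Nat.lt_succ_of_le (le_max_left _ _)),
      h q (Nat.lt_succ_of_le (le_max_right _ _))]

theorem subset_recognizes (p q : ℕ) : (subset F p q).Recognizes (.subset p q) := by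
  intro fr r hr V
  rw [mem_win_iff_of_true rfl]
  constructor
  · intro (h : V p ⊆ V q)
    exact ⟨Set.univ, trivial, fun t _ => ⟨fun ht => h ht, fun c => trivial⟩⟩
  · rintro ⟨D, h0, hD⟩ s hs
    exact (hD (hr.ind (fun s => ((), s) ∈ D) h0 (fun s c hs => (hD hs).2 c) s)).1 hs

/-- The automaton checking that `λ_i(q)` holds wherever `p` is true. -/
def lift (i : F.ι) (p : ℕ) (q : Fin (F.ar i) → ℕ) : Aut F where
  A := Option (Fin (F.ar i))
  finite := inferInstance
  start := none
  Ω _ := 0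
  E _ := True
  δ a c X α V := a.elim ((p ∈ c → α ∈ (F.lf i).app X fun k => V (some k)) ∧ ∀ x : X, x ∈ V none)
    fun k => q k ∈ c
  bound := max p (Finset.univ.sup q) + 1
  mono a c X α V V' hV h := by
    cases a with
    | none => exact ⟨fun hp => F.mono i X _ _ (fun k => hV (some k)) (h.1 hp),
        fun x => hV _ (h.2 x)⟩
    | some k => exact h
  sodef a c := by
    cases a with
    | none => exact ((SODef.const _).imp (.lift i some)).and (.univ_subset none)
    | some k => exact .const _
  congr a c c' h := by
    have hq : ∀ k, q k ∈ c ↔ q k ∈ c' := fun k => h _ <| Nat.lt_succ_of_le <|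
      (Finset.le_sup (f := q) (Finset.mem_univ k)).trans (le_max_right _ _)
    simp only [h p (Nat.lt_succ_of_le (le_max_left _ _)), hq]

theorem lift_recognizes (i : F.ι) (p : ℕ) (q : Fin (F.ar i) → ℕ) :
    (lift i p q).Recognizes (.lift i p q) := by
  intro fr r hr V
  rw [mem_win_iff_of_true rfl]
  have hnat : ∀ s, fr.σ s ∈ (F.lf i).app fr.S (fun k => V (q k)) ↔
      fr.α s ∈ (F.lf i).app (fr.C s) fun k => fr.e s ⁻¹' V (q k) := by
    intro s
    rw [(F.lf i).natural]
    rfl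
  constructor
  · intro h
    refine ⟨{t | ∀ k, t.1 = some k → t.2 ∈ V (q k)}, fun k (hk : none = some k) => (nomatch hk), ?_⟩
    rintro ⟨_ | k, s⟩ ht
    · refine ⟨fun hp => F.mono i _ _ _ (fun k c hc k' hk' => ?_) ((hnat s).1 (h s hp)),
        fun c k (hk : none = some k) => nomatch hk⟩
      obtain rfl := Option.some_injective _ hk'
      exact hc
    · exact ht k rfl
  · rintro ⟨D, h0, hD⟩ s hs
    have hall : ∀ s, (none, s) ∈ D := hr.ind (fun s => (none, s) ∈ D) h0 fun s c hs => (hD hs).2 c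
    rw [hnat]
    exact F.mono i _ _ _ (fun k c (hc : (some k, fr.e s c) ∈ D) => hD hc) ((hD (hall s)).1 hs)

/-- The complement automaton. -/
def neg (𝔸 : Aut F) : Aut F where
  A := 𝔸.A
  finite := inferInstance
  start := 𝔸.start
  Ω := 𝔸.Ω
  E m := ¬ 𝔸.E m
  δ a c X α V := ¬ 𝔸.δ a c X α fun b => (V b)ᶜ
  bound := 𝔸.bound
  mono _ _ _ _ _ _ hV h h' := h (𝔸.mono _ _ _ _ _ _ (fun b => Set.compl_subset_compl.2 (hV b)) h')
  sodef a c := (𝔸.sodef a c).comp_compl.neg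
  congr a c c' h := by rw [𝔸.congr a c c' h]

theorem neg_recognizes {𝔸 : Aut F} {φ : MSOForm F} (h : 𝔸.Recognizes φ) :
    𝔸.neg.Recognizes (.neg φ) := by
  intro fr r hr V
  obtain ⟨n, hn⟩ := 𝔸.exists_lt
  have hcompl : (𝔸.win fr V)ᶜ = 𝔸.neg.win fr V :=
    compl_win (Ω := fun p : 𝔸.A × fr.S => 𝔸.Ω p.1) (fun p => hn p.1) (𝔸.op_mono fr V)
  rw [← hcompl]
  exact not_congr (h fr r hr V)

/-- The disjoint union of two automata with a new initial state. -/
def or (𝔸 𝔹 : Aut F) : Aut F where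
  A := Option (𝔸.A ⊕ 𝔹.A)
  finite := inferInstance
  start := none
  Ω a := a.elim 0 (Sum.elim (fun a => 2 * 𝔸.Ω a) fun b => 2 * 𝔹.Ω b + 1)
  E m := if Even m then 𝔸.E (m / 2) else 𝔹.E (m / 2)
  δ a c X α V := a.elim
    (𝔸.δ 𝔸.start c X α (fun b => V (some (.inl b))) ∨
      𝔹.δ 𝔹.start c X α fun b => V (some (.inr b)))
    (Sum.elim (fun a => 𝔸.δ a c X α fun b => V (some (.inl b)))
      fun a => 𝔹.δ a c X α fun b => V (some (.inr b)))
  bound := max 𝔸.bound 𝔹.bound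
  mono a c X α V V' hV := by
    rcases a with _ | a | a
    · exact Or.imp (𝔸.mono _ _ _ _ _ _ fun _ => hV _) (𝔹.mono _ _ _ _ _ _ fun _ => hV _)
    · exact 𝔸.mono _ _ _ _ _ _ fun _ => hV _
    · exact 𝔹.mono _ _ _ _ _ _ fun _ => hV _
  sodef a c := by
    rcases a with _ | a | a
    · exact ((𝔸.sodef _ _).rename _).or ((𝔹.sodef _ _).rename _)
    · exact (𝔸.sodef _ _).rename _
    · exact (𝔹.sodef _ _).rename _
  congr a c c' h := by
    have h1 : ∀ a, 𝔸.δ a c = 𝔸.δ a c' := fun a =>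
      𝔸.congr a c c' fun q hq => h q (hq.trans_le (le_max_left _ _))
    have h2 : ∀ a, 𝔹.δ a c = 𝔹.δ a c' := fun a =>
      𝔹.congr a c c' fun q hq => h q (hq.trans_le (le_max_right _ _))
    simp only [h1, h2]

theorem or_recognizes {𝔸 𝔹 : Aut F} {φ ψ : MSOForm F} (hφ : 𝔸.Recognizes φ)
    (hψ : 𝔹.Recognizes ψ) : (or 𝔸 𝔹).Recognizes (.or φ ψ) := by
  intro fr r hr V
  obtain ⟨n, hn⟩ := 𝔸.exists_lt
  obtain ⟨m, hm⟩ := 𝔹.exists_lt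
  obtain ⟨l, hl⟩ := (or 𝔸 𝔹).exists_lt
  have h1 : ∀ p, p ∈ 𝔸.win fr V ↔ (some (.inl p.1), p.2) ∈ (or 𝔸 𝔹).win fr V := by
    refine mem_win_comap (fun p : 𝔸.A × fr.S => ((some (.inl p.1) : (or 𝔸 𝔹).A), p.2))
      (fun Y => rfl) (fun x => ?_) (fun p => hl p.1) (fun p => hn p.1) ((or 𝔸 𝔹).op_mono fr V)
      (𝔸.op_mono fr V)
    refine (limsupIn_comp (f := fun m => 2 * m) (fun a b hab => Nat.mul_le_mul_left 2 hab)
      (N := n) fun i => (hn (x i).1).le).symm.trans (iff_of_eq ?_)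
    congr 1
    funext m
    simp [or]
  have h2 : ∀ p, p ∈ 𝔹.win fr V ↔ (some (.inr p.1), p.2) ∈ (or 𝔸 𝔹).win fr V := by
    refine mem_win_comap (fun p : 𝔹.A × fr.S => ((some (.inr p.1) : (or 𝔸 𝔹).A), p.2))
      (fun Y => rfl) (fun x => ?_) (fun p => hl p.1) (fun p => hm p.1) ((or 𝔸 𝔹).op_mono fr V)
      (𝔹.op_mono fr V)
    refine (limsupIn_comp (f := fun m => 2 * m + 1)
      (fun a b hab => Nat.succ_le_succ (Nat.mul_le_mul_left 2 hab))
      (N := m) fun i => (hm (x i).1).le).symm.trans (iff_of_eq ?_)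
    congr 1
    funext m
    have : (2 * m + 1) / 2 = m := by omega
    simp [or, this]
  refine (or_congr (hφ fr r hr V) (hψ fr r hr V)).trans ?_
  rw [← (or 𝔸 𝔹).op_win, ← 𝔸.op_win, ← 𝔹.op_win]
  refine or_congr (iff_of_eq ?_) (iff_of_eq ?_)
  · exact congrArg (𝔸.δ _ _ _ _) (funext fun b => Set.ext fun c => h1 (b, fr.e r c))
  · exact congrArg (𝔹.δ _ _ _ _) (funext fun b => Set.ext fun c => h2 (b, fr.e r c))

end Aut

/-- Changing whether `p` belongs to a colour. -/
def recolor (p : ℕ) (b : Prop) (c : Set ℕ) : Set ℕ := {q | if q = p then b else q ∈ c}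

theorem setOf_mem_updW {S : Type} (V : ℕ → Set S) (p : ℕ) (Z : Set S) (s : S) :
    {q | s ∈ updW V p Z q} = recolor p (s ∈ Z) {q | s ∈ V q} := by
  ext q
  by_cases h : q = p <;> simp [updW, recolor, h]

namespace Aut

variable {T : SetFunctor} {F : LiftingFamily T} {fr : Frame T}

section Projection

variable {D A : Type} (d : D) (step : D → Set (A × A) → D) (a : A)

/-- The next state of the deterministic automaton. -/
def nextState : Option (D × Set (A × A)) → D
  | none => d
  | some (d', R) => step d' R

/-- The states of the projected automaton that are simulated by a state of the projection. -/
def activeStates : Option (D × Set (A × A)) → Set A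
  | none => {a}
  | some (_, R) => {b | ∃ b', (b', b) ∈ R}

/-- One step of the projection automaton: guess the value of a variable and moves of the
simulated automaton, and send each successor the relation formed by the moves leading to it. -/
def projStep (δ : A → Set ℕ → OneStep T A) (p : ℕ) (β : Option (D × Set (A × A))) (c : Set ℕ) :
    OneStep T (Option (D × Set (A × A))) := fun X α V =>
  ∃ (b : Prop) (Z : A × A → Set X),
    (∀ x, x ∈ V (some (nextState d step β, {t | x ∈ Z t}))) ∧
    ∀ a' ∈ activeStates a β, δ a' (recolor p b c) X α fun b' => Z (a', b')

variable {d step a}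

theorem sodef_projStep [Finite A] {δ : A → Set ℕ → OneStep T A} (h : ∀ a c, SODef F A (δ a c))
    (p : ℕ) (β : Option (D × Set (A × A))) (c : Set ℕ) :
    SODef F _ (projStep d step a δ p β c) := by
  have hb : ∀ b : Prop, SODef F (Option (D × Set (A × A))) fun X α V => ∃ Z : A × A → Set X,
      (∀ x, x ∈ V (some (nextState d step β, {t | x ∈ Z t}))) ∧
      ∀ a' ∈ activeStates a β, δ a' (recolor p b c) X α fun b' => Z (a', b') := by
    intro b
    have h2 : SODef F (Option (D × Set (A × A)) ⊕ A × A) fun X α V =>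
        ∀ a', a' ∈ activeStates a β →
          δ a' (recolor p b c) X α fun b' => V (.inr (a', b')) :=
      .forall_finite fun a' => .imp (.const _) ((h a' _).rename fun b' =>
        (.inr (a', b') : Option (D × Set (A × A)) ⊕ A × A))
    have h1 : SODef F (Option (D × Set (A × A)) ⊕ A × A) fun X α V =>
        ∀ x, x ∈ V (.inl (some (nextState d step β, {t | x ∈ V (.inr t)}))) := by
      refine (SODef.forall_finite fun R : Set (A × A) => SODef.all (SODef.imp
        (.forall_finite fun t : A × A => SODef.and
          (.imp (.const (t ∈ R)) (.subset none (some (.inr t))))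
          (.imp (.const (t ∉ R)) (.disjoint none (some (.inr t)))))
        (.subset none (some (.inl (some (nextState d step β, R))))))).congr fun X α V => ?_
      constructor
      · intro hV x
        refine hV _ {x} (fun t => ⟨fun ht => ?_, fun ht => ?_⟩) rfl
        · exact Set.singleton_subset_iff.2 ht
        · rintro _ rfl
          exact ht
      · intro hV R W hW x hx
        have : {t | x ∈ V (.inr t)} = R := by
          ext t
          refine ⟨fun ht => ?_, fun ht => (hW t).1 ht hx⟩
          by_contra hn
          exact (hW t).2 hn x hx ht
        exact this ▸ hV x
    exact (h1.and h2).exists_family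
  refine ((hb True).or (hb False)).congr fun X α V => ?_
  constructor
  · rintro (h | h)
    exacts [⟨_, h⟩, ⟨_, h⟩]
  · rintro ⟨b, h⟩
    by_cases hb : b
    · exact Or.inl (by simpa [hb] using h)
    · exact Or.inr (by simpa [hb] using h)

/-- The projection of an automaton, built from a deterministic automaton for its traces. -/
def ex [Finite D] (𝔸 : Aut F) (p : ℕ) (d : D) (step : D → Set (𝔸.A × 𝔸.A) → D)
    (prio : D → Set (𝔸.A × 𝔸.A) → ℕ) (E : ℕ → Prop) : Aut F where
  A := Option (D × Set (𝔸.A × 𝔸.A))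
  finite := inferInstance
  start := none
  Ω β := β.elim 0 fun t => prio t.1 t.2
  E := E
  δ := projStep d step 𝔸.start 𝔸.δ p
  bound := 𝔸.bound
  mono _ _ _ _ _ _ hV := fun ⟨b, Z, h1, h2⟩ => ⟨b, Z, fun x => hV _ (h1 x), h2⟩
  sodef := sodef_projStep 𝔸.sodef p
  congr β c c' h := by
    funext X α V
    have : ∀ b a', 𝔸.δ a' (recolor p b c) = 𝔸.δ a' (recolor p b c') := fun b a' =>
      𝔸.congr a' _ _ fun q hq => by
        by_cases hqp : q = p
        · simp [recolor, hqp]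
        · simpa [recolor, hqp] using h q hq
    simp only [projStep, this]

end Projection

section Projection

variable {D : Type} [Finite D] {𝔸 : Aut F} {p : ℕ} {d : D} {step : D → Set (𝔸.A × 𝔸.A) → D}
  {prio : D → Set (𝔸.A × 𝔸.A) → ℕ} {E : ℕ → Prop}

/-- The sequence of states of the projection automaton and the corresponding run of the
deterministic automaton. -/
theorem limsupIn_projection {β : ℕ → Option (D × Set (𝔸.A × 𝔸.A))}
    {R : ℕ → Set (𝔸.A × 𝔸.A)} (h0 : β 0 = none)
    (hβ : ∀ i, β (i + 1) = some (nextState d step (β i), R i)) :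
    (LimsupIn E fun i => (ex 𝔸 p d step prio E).Ω (β i)) ↔
      LimsupIn E fun k => prio (detRun d step R k) (R k) := by
  have hrun : ∀ i, nextState d step (β i) = detRun d step R i := by
    intro i
    induction i with
    | zero => rw [h0]; rfl
    | succ i ih => rw [hβ, ih]; rfl
  rw [← limsupIn_tail 1]
  refine iff_of_eq ?_
  congr 1
  funext i
  rw [hβ, hrun]
  rfl

theorem mem_win_ex_of_exists
    (hdet : ∀ R : ℕ → Set (𝔸.A × 𝔸.A),
      (∀ x : ℕ → 𝔸.A, x 0 = 𝔸.start → (∀ i, (x i, x (i + 1)) ∈ R i) →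
        LimsupIn 𝔸.E fun i => 𝔸.Ω (x i)) ↔ LimsupIn E fun k => prio (detRun d step R k) (R k))
    {r : fr.S} (hr : fr.IsTree r) {V : ℕ → Set fr.S} {Z : Set fr.S}
    (h : (𝔸.start, r) ∈ 𝔸.win fr (updW V p Z)) :
    ((ex 𝔸 p d step prio E).start, r) ∈ (ex 𝔸 p d step prio E).win fr V := by
  obtain ⟨Y, hY⟩ := exists_isWinning_win 𝔸.E (fun q : 𝔸.A × fr.S => 𝔸.Ω q.1)
    (𝔸.op fr (updW V p Z))
  let W := 𝔸.win fr (updW V p Z)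
  let ρ : (s : fr.S) → fr.C s → Set (𝔸.A × 𝔸.A) := fun s c =>
    {t | (t.1, s) ∈ W ∧ (t.2, fr.e s c) ∈ Y (t.1, s)}
  obtain ⟨g, hg0, hg⟩ := hr.exists_rec (Option (D × Set (𝔸.A × 𝔸.A))) none
    fun s β c => some (nextState d step β, ρ s c)
  have hact : ∀ s, ∀ a ∈ activeStates 𝔸.start (g s), (a, s) ∈ W := by
    refine hr.ind _ ?_ fun s c _ a ha => ?_
    · rw [hg0]
      rintro a rfl
      exact h
    · rw [hg] at ha
      obtain ⟨b, hb1, hb2⟩ := ha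
      exact hY.closed _ hb1 hb2
  refine mem_win_of_start (D := {q | q.1 = g q.2})
    (Y := fun q => {q' | ∃ c, q' = (g (fr.e q.2 c), fr.e q.2 c)}) ?_ ?_ ?_ ?_
  · exact hg0.symm
  · rintro ⟨β, s⟩ (hβ : β = g s)
    subst hβ
    refine ⟨s ∈ Z, fun t => {c | t ∈ ρ s c}, fun c => ⟨c, by rw [hg]; rfl⟩, fun a ha => ?_⟩
    have hen := hY.enabled (a, s) (hact s a ha)
    simp only [op, Set.mem_ofPred_eq, setOf_mem_updW] at hen
    exact 𝔸.mono _ _ _ _ _ _ (fun b c hc => ⟨hact s a ha, hc⟩) hen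
  · rintro ⟨_, s⟩ _ _ ⟨c, rfl⟩
    exact rfl
  · intro x hx0 hx
    choose c hc using hx
    have hxg : ∀ i, (x i).1 = g (x i).2 := by
      intro i
      cases i with
      | zero => rw [hx0]; exact hg0.symm
      | succ i => rw [hc]
    refine (limsupIn_projection (β := fun i => (x i).1) (R := fun i => ρ (x i).2 (c i))
      (by rw [hx0]; rfl) fun i => ?_).2 ((hdet _).1 fun y hy0 hy => ?_)
    · rw [hc, hg, hxg]
    · refine hY.parity (fun i => (y i, (x i).2)) ?_ fun i => ?_
      · change (y 0, (x 0).2) ∈ W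
        rw [hy0, hx0]
        exact h
      · rw [hc i]
        exact (hy i).2

theorem exists_of_mem_win_ex
    (hdet : ∀ R : ℕ → Set (𝔸.A × 𝔸.A),
      (∀ x : ℕ → 𝔸.A, x 0 = 𝔸.start → (∀ i, (x i, x (i + 1)) ∈ R i) →
        LimsupIn 𝔸.E fun i => 𝔸.Ω (x i)) ↔ LimsupIn E fun k => prio (detRun d step R k) (R k))
    {r : fr.S} (hr : fr.IsTree r) {V : ℕ → Set fr.S}
    (h : ((ex 𝔸 p d step prio E).start, r) ∈ (ex 𝔸 p d step prio E).win fr V) :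
    ∃ Z, (𝔸.start, r) ∈ 𝔸.win fr (updW V p Z) := by
  set 𝔹 := ex 𝔸 p d step prio E
  obtain ⟨Y, hY⟩ := exists_isWinning_win 𝔹.E (fun q : 𝔹.A × fr.S => 𝔹.Ω q.1) (𝔹.op fr V)
  have hwit : ∀ (β : 𝔹.A) (s : fr.S), ∃ (b : Prop) (Z : 𝔸.A × 𝔸.A → Set (fr.C s)),
      (β, s) ∈ 𝔹.win fr V →
      (∀ c, (some (nextState d step β, {t | c ∈ Z t}), fr.e s c) ∈ Y (β, s)) ∧
      ∀ a' ∈ activeStates 𝔸.start β, 𝔸.δ a' (recolor p b {u | s ∈ V u}) (fr.C s) (fr.α s)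
        fun b' => Z (a', b') := by
    intro β s
    by_cases hq : (β, s) ∈ 𝔹.win fr V
    · obtain ⟨b, Z, h1, h2⟩ := hY.enabled _ hq
      exact ⟨b, Z, fun _ => ⟨h1, h2⟩⟩
    · exact ⟨True, fun _ => ∅, fun h => absurd h hq⟩
  choose b Z hZ using hwit
  obtain ⟨g, hg0, hg⟩ := hr.exists_rec (Option (D × Set (𝔸.A × 𝔸.A))) none
    fun s β c => some (nextState d step β, {t | c ∈ (Z β s t : Set (fr.C s))})
  have hW : ∀ s, (g s, s) ∈ 𝔹.win fr V := by
    refine hr.ind _ ?_ fun s c hs => ?_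
    · rw [hg0]
      exact h
    · have := (hZ _ _ hs).1 c
      rw [← hg] at this
      exact hY.closed _ hs this
  refine ⟨{s | b (g s) s}, mem_win_of_start (D := {q | q.1 ∈ activeStates 𝔸.start (g q.2)})
    (Y := fun q => {q' | ∃ c : fr.C q.2, q'.2 = fr.e q.2 c ∧
      c ∈ Z (g q.2) q.2 (q.1, q'.1)}) ?_ ?_ ?_ ?_⟩
  · change 𝔸.start ∈ activeStates 𝔸.start (g r)
    rw [hg0]
    rfl
  · rintro ⟨a, s⟩ ha
    have hen := (hZ _ _ (hW s)).2 a ha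
    simp only [op, Set.mem_ofPred_eq, setOf_mem_updW]
    exact 𝔸.mono _ _ _ _ _ _ (fun b c hc => ⟨c, rfl, hc⟩) hen
  · rintro ⟨a, s⟩ ha ⟨a', s'⟩ ⟨c, hs', hc⟩
    obtain rfl : s' = fr.e s c := hs'
    change a' ∈ activeStates 𝔸.start (g (fr.e s c))
    rw [hg]
    exact ⟨a, hc⟩
  · intro x hx0 hx
    choose c hc hcZ using hx
    have hplay : LimsupIn 𝔹.E fun i => 𝔹.Ω (g (x i).2) := by
      refine hY.parity (fun i => (g (x i).2, (x i).2)) (hW _) fun i => ?_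
      change (g (x (i + 1)).2, (x (i + 1)).2) ∈ Y (g (x i).2, (x i).2)
      have := (hZ _ _ (hW (x i).2)).1 (c i)
      rwa [← hg, ← hc] at this
    have hlim := (limsupIn_projection (β := fun i => g (x i).2)
      (R := fun i => {t | c i ∈ Z (g (x i).2) (x i).2 t}) (by rw [hx0]; exact hg0)
      fun i => by rw [hc, hg]).1 hplay
    exact (hdet _).2 hlim (fun i => (x i).1) (by rw [hx0]) hcZ

end Projection

theorem exists_recognizes_ex {𝔸 : Aut F} {φ : MSOForm F} (h : 𝔸.Recognizes φ) (p : ℕ) :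
    ∃ 𝔹 : Aut F, 𝔹.Recognizes (.ex p φ) := by
  obtain ⟨D, hD, d, step, prio, N, E, -, hdet⟩ :=
    exists_deterministic_trace_parity 𝔸.Ω 𝔸.E 𝔸.start
  refine ⟨ex 𝔸 p d step prio E, fun fr r hr V => ⟨?_, fun hw => ?_⟩⟩
  · rintro ⟨Z, hZ⟩
    exact mem_win_ex_of_exists hdet hr ((h fr r hr _).1 hZ)
  · exact (exists_of_mem_win_ex hdet hr hw).imp fun Z => (h fr r hr _).2

/-- Every formula of coalgebraic monadic second-order logic is equivalent to an automaton over
trees. -/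
theorem exists_recognizes (φ : MSOForm F) : ∃ 𝔸 : Aut F, 𝔸.Recognizes φ := by
  induction φ with
  | bot => exact ⟨_, bot_recognizes⟩
  | sr p => exact ⟨_, sr_recognizes p⟩
  | subset p q => exact ⟨_, subset_recognizes p q⟩
  | lift i p q => exact ⟨_, lift_recognizes i p q⟩
  | or φ ψ ih₁ ih₂ => exact ih₁.elim fun _ h₁ => ih₂.elim fun _ h₂ => ⟨_, or_recognizes h₁ h₂⟩
  | neg φ ih => exact ih.elim fun _ h => ⟨_, neg_recognizes h⟩
  | ex p φ ih => exact ih.elim fun _ h => exists_recognizes_ex h p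

end Aut

namespace Frame

variable {T : SetFunctor}

/-- Finite paths in a frame starting at `u`. -/
inductive Path (fr : Frame T) (u : fr.S) : fr.S → Type
  | nil : Path fr u u
  | cons {s : fr.S} (π : Path fr u s) (c : fr.C s) : Path fr u (fr.e s c)

/-- The tree unravelling of a frame. -/
def unravel (fr : Frame T) (u : fr.S) : Frame T where
  S := Σ s, fr.Path u s
  C x := fr.C x.1
  α x := fr.α x.1
  e x c := ⟨_, x.2.cons c⟩

theorem map_fst_unravel_σ (fr : Frame T) (u : fr.S) (x : (fr.unravel u).S) :
    T.map Sigma.fst ((fr.unravel u).σ x) = fr.σ x.1 :=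
  (T.map_comp _ _ _).symm

/-- Recursion along a path. -/
def Path.foldPath {fr : Frame T} {u : fr.S} {B : Type} (b : B)
    (f : (x : (fr.unravel u).S) → B → fr.C x.1 → B) : {s : fr.S} → fr.Path u s → B
  | _, .nil => b
  | _, .cons (s := s) π c => f ⟨s, π⟩ (π.foldPath b f) c

theorem isTree_unravel (fr : Frame T) (u : fr.S) : (fr.unravel u).IsTree ⟨u, .nil⟩ where
  exists_rec _ b f := ⟨fun x => x.2.foldPath b f, rfl, fun _ _ => rfl⟩
  ind P h0 hs := by
    rintro ⟨s, π⟩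
    induction π with
    | nil => exact h0
    | cons π c ih => exact hs ⟨_, π⟩ c ih
  root_ne s c h := by
    have h2 : ∀ x y : (fr.unravel u).S, x = y →
        x.2.foldPath (B := Prop) True (fun _ _ _ => False) →
        y.2.foldPath (B := Prop) True (fun _ _ _ => False) := by
      rintro x _ rfl h
      exact h
    exact h2 _ _ h.symm trivial

/-- The frame obtained by applying a uniform construction to a coalgebra. -/
def ofUniform (U : UniformConstruction T) {S : Type} (σ : S → T.obj S) : Frame T where
  S := S
  C s := U.star S (σ s)
  α s := U.el S (σ s)
  e s := U.h S (σ s)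

theorem ofUniform_σ (U : UniformConstruction T) {S : Type} (σ : S → T.obj S) (s : S) :
    (ofUniform U σ).σ s = σ s :=
  U.spec _ _

end Frame

theorem Aut.mem_win_unravel {T : SetFunctor} {F : LiftingFamily T} (𝔸 : Aut F) (fr : Frame T)
    (u : fr.S) (V : ℕ → Set fr.S) (p : 𝔸.A × (fr.unravel u).S) :
    p ∈ 𝔸.win (fr.unravel u) (fun q => Sigma.fst ⁻¹' V q) ↔ (p.1, p.2.1) ∈ 𝔸.win fr V := by
  obtain ⟨n, hn⟩ := 𝔸.exists_lt
  exact mem_win_comap (F := 𝔸.op fr V) (F' := 𝔸.op (fr.unravel u) _)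
    (fun p : 𝔸.A × (fr.unravel u).S => (p.1, p.2.1)) (fun Y => rfl)
    (fun x => Iff.rfl) (fun p => hn p.1) (fun p => hn p.1) (𝔸.op_mono fr V)
    (𝔸.op_mono (fr.unravel u) _) p

theorem BisimInv.sat_iff_mem_win {T : SetFunctor} {F : LiftingFamily T} {φ : MSOForm F}
    (hφ : BisimInv φ) {𝔸 : Aut F} (h𝔸 : 𝔸.Recognizes φ) (U : UniformConstruction T)
    (M : TModel T) (u : M.S) :
    φ.sat M.σ M.V u ↔ (𝔸.start, u) ∈ 𝔸.win (Frame.ofUniform U M.σ) M.V := by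
  let fr := Frame.ofUniform U M.σ
  have hfr := h𝔸 _ _ (fr.isTree_unravel u) fun q => Sigma.fst ⁻¹' M.V q
  refine Iff.trans ?_ (hfr.trans (𝔸.mem_win_unravel fr u M.V _))
  refine hφ M u ⟨(fr.unravel u).S, (fr.unravel u).σ, fun q => Sigma.fst ⁻¹' M.V q⟩ ⟨u, .nil⟩
    ⟨M, id, Sigma.fst, ⟨fun _ _ => Iff.rfl, fun _ => (T.map_id _).symm⟩,
      ⟨fun _ _ => Iff.rfl, fun x => ?_⟩, rfl⟩
  exact (Frame.ofUniform_σ U M.σ x.1).symm.trans (fr.map_fst_unravel_σ u x).symm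

/-- The operator of the acceptance game of a modal automaton. -/
def modalOp {T : SetFunctor} {F : LiftingFamily T} {A S : Type} (χ : A → Set ℕ → ML1 F A)
    (N : ℕ) (σ : S → T.obj S) (V : ℕ → Set S) (Y : Set (A × S)) : Set (A × S) :=
  {p | (χ p.1 {q | q < N ∧ p.2 ∈ V q}).sat S (σ p.2) fun b => {s | (b, s) ∈ Y}}

/-- Over the frames of a suitable uniform construction, an automaton is equivalent to a modal
automaton. -/
theorem Aut.exists_modal {T : SetFunctor} {F : LiftingFamily T} (hec : ExpressivelyComplete F)
    (had : AdmitsAdequateUniformConstruction T) (𝔸 : Aut F) :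
    ∃ (U : UniformConstruction T) (χ : 𝔸.A → Set ℕ → ML1 F 𝔸.A),
      ∀ (S : Type) (σ : S → T.obj S) (V : ℕ → Set S),
        𝔸.op (Frame.ofUniform U σ) V = modalOp χ 𝔸.bound σ V := by
  choose φ hφ hsat using fun a c => (𝔸.sodef a c).exists_sentence
  let restr : Set (Fin 𝔸.bound) → Set ℕ := fun c => {q | ∃ h : q < 𝔸.bound, ⟨q, h⟩ ∈ c}
  obtain ⟨k, hk⟩ := (Set.finite_range fun t : 𝔸.A × Set (Fin 𝔸.bound) =>
    (φ t.1 (restr t.2)).qd).bddAbove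
  obtain ⟨U, hU⟩ := had F k
  have hmono : ∀ a c, MonotoneSent (φ a c) := fun a c X α V V' hV h =>
    (hsat ..).2 (𝔸.mono _ _ _ _ _ _ hV ((hsat ..).1 h))
  have hχ : ∀ a c, ∃ χ : ML1 F 𝔸.A, ∀ X α V,
      χ.sat X α V ↔ 𝔸.δ a (restr c) (U.star X α) (U.el X α) fun b => U.h X α ⁻¹' V b := by
    intro a c
    let g : GenLifting T 𝔸.A :=
      ⟨fun X V => {α | (φ a (restr c)).sat0 (U.star X α) (U.el X α) fun b => U.h X α ⁻¹' V b}⟩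
    have hnat : g.Natural := fun X Y f V => Set.ext fun α =>
      hU X Y f α _ rfl 𝔸.A 𝔸.finite V _ (hφ _ _) (hmono _ _) (hk ⟨(a, c), rfl⟩)
    have hgm : g.Mono := fun X V V' hV α h =>
      hmono _ _ _ _ _ _ (fun b => Set.preimage_mono (hV b)) h
    obtain ⟨χ, hχ⟩ := hec 𝔸.A 𝔸.finite g hnat hgm
    exact ⟨χ, fun X α V => (hχ X α V).trans (hsat ..)⟩
  choose χ hχ using hχ
  refine ⟨U, fun a c => χ a {q | q.1 ∈ c}, fun S σ V => ?_⟩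
  funext Y
  refine Set.ext fun p => Iff.trans (iff_of_eq ?_) (hχ ..).symm
  refine congrFun (congrFun (congrFun (𝔸.congr p.1 _ _ fun q hq => ?_) _) _) _
  exact ⟨fun h => ⟨hq, hq, h⟩, fun ⟨_, _, h⟩ => h⟩

section GameToFormula

variable {T : SetFunctor} {F : LiftingFamily T} {A S : Type}

/-- Substitution of formulas of the `μ`-calculus into a lattice term. -/
def LatTerm.subst (θ : A → MuForm F) : LatTerm A → MuForm F
  | .var a => θ a
  | .and s t => .and (s.subst θ) (t.subst θ)
  | .or s t => .or (s.subst θ) (t.subst θ)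

/-- Substitution of formulas of the `μ`-calculus into a one-step formula. -/
def ML1.subst (θ : A → MuForm F) : ML1 F A → MuForm F
  | .bot => .bot
  | .top => .top
  | .lift i ψ => .lift i fun k => (ψ k).subst θ
  | .or φ ψ => .or (φ.subst θ) (ψ.subst θ)
  | .and φ ψ => .and (φ.subst θ) (ψ.subst θ)

theorem LatTerm.sem_subst (σ : S → T.obj S) (V : ℕ → Set S) (θ : A → MuForm F) (t : LatTerm A) :
    (t.subst θ).sem σ V = t.sem fun b => (θ b).sem σ V := by
  induction t with
  | var a => rfl
  | and s t ihs iht => simp [subst, MuForm.sem, LatTerm.sem, ihs, iht]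
  | or s t ihs iht => simp [subst, MuForm.sem, LatTerm.sem, ihs, iht]

theorem ML1.mem_sem_subst (σ : S → T.obj S) (V : ℕ → Set S) (θ : A → MuForm F) (φ : ML1 F A)
    (s : S) : s ∈ (φ.subst θ).sem σ V ↔ φ.sat S (σ s) fun b => (θ b).sem σ V := by
  induction φ with
  | bot => exact Iff.rfl
  | top => exact iff_of_true trivial trivial
  | lift i ψ => simp [subst, MuForm.sem, ML1.sat, LatTerm.sem_subst]
  | or φ ψ ihφ ihψ => exact or_congr ihφ ihψ
  | and φ ψ ihφ ihψ => exact and_congr ihφ ihψ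

theorem LatTerm.subst_prop {P : MuForm F → Prop} (hand : ∀ φ ψ, P φ → P ψ → P (.and φ ψ))
    (hor : ∀ φ ψ, P φ → P ψ → P (.or φ ψ)) {θ : A → MuForm F} (h : ∀ a, P (θ a))
    (t : LatTerm A) : P (t.subst θ) := by
  induction t with
  | var a => exact h a
  | and s t ihs iht => exact hand _ _ ihs iht
  | or s t ihs iht => exact hor _ _ ihs iht

theorem ML1.posIn_subst {p : ℕ} {θ : A → MuForm F} (h : ∀ a, (θ a).PosIn p) (φ : ML1 F A) :
    (φ.subst θ).PosIn p := by
  induction φ with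
  | bot => trivial
  | top => trivial
  | lift i ψ => exact fun k => LatTerm.subst_prop (fun _ _ => .intro) (fun _ _ => .intro) h (ψ k)
  | or φ ψ ihφ ihψ => exact ⟨ihφ, ihψ⟩
  | and φ ψ ihφ ihψ => exact ⟨ihφ, ihψ⟩

theorem ML1.wf_subst {θ : A → MuForm F} (h : ∀ a, (θ a).WF) (φ : ML1 F A) :
    (φ.subst θ).WF := by
  induction φ with
  | bot => trivial
  | top => trivial
  | lift i ψ => exact fun k => LatTerm.subst_prop (fun _ _ => .intro) (fun _ _ => .intro) h (ψ k)
  | or φ ψ ihφ ihψ => exact ⟨ihφ, ihψ⟩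
  | and φ ψ ihφ ihψ => exact ⟨ihφ, ihψ⟩

/-- The formula `f c`, where `c` is the set of variables below `N` that are true. -/
def colorCase : ℕ → (Set ℕ → MuForm F) → MuForm F
  | 0, f => f ∅
  | N + 1, f => .or (.and (.var N) (colorCase N fun c => f (insert N c)))
      (.and (.nvar N) (colorCase N f))

theorem mem_sem_colorCase (σ : S → T.obj S) (V : ℕ → Set S) (s : S) (N : ℕ)
    (f : Set ℕ → MuForm F) :
    s ∈ (colorCase N f).sem σ V ↔ s ∈ (f {q | q < N ∧ s ∈ V q}).sem σ V := by
  induction N generalizing f with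
  | zero => simp [colorCase]
  | succ N ih =>
    simp only [colorCase, MuForm.sem, Set.mem_union, Set.mem_inter_iff, Set.mem_compl_iff, ih]
    by_cases h : s ∈ V N
    · have : insert N {q | q < N ∧ s ∈ V q} = {q | q < N + 1 ∧ s ∈ V q} := by
        ext q
        simp only [Set.mem_insert_iff, Set.mem_ofPred_eq, Nat.lt_succ_iff_lt_or_eq]
        constructor
        · rintro (rfl | h')
          exacts [⟨.inr rfl, h⟩, ⟨.inl h'.1, h'.2⟩]
        · rintro ⟨h' | rfl, h''⟩
          exacts [.inr ⟨h', h''⟩, .inl rfl]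
      simp [h, this]
    · have : {q | q < N ∧ s ∈ V q} = {q | q < N + 1 ∧ s ∈ V q} := by
        ext q
        simp only [Set.mem_ofPred_eq, Nat.lt_succ_iff_lt_or_eq]
        constructor
        · rintro ⟨h', h''⟩
          exact ⟨.inl h', h''⟩
        · rintro ⟨h' | rfl, h''⟩
          exacts [⟨h', h''⟩, absurd h'' h]
      simp [h, this]

theorem posIn_colorCase {p N : ℕ} (hp : N ≤ p) {f : Set ℕ → MuForm F}
    (h : ∀ c, (f c).PosIn p) : (colorCase N f).PosIn p := by
  induction N generalizing f with
  | zero => exact h _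
  | succ N ih =>
    have hN : N ≤ p := by omega
    exact ⟨⟨trivial, ih hN fun _ => h _⟩, fun h => by omega, ih hN h⟩

theorem wf_colorCase (N : ℕ) {f : Set ℕ → MuForm F} (h : ∀ c, (f c).WF) :
    (colorCase N f).WF := by
  induction N generalizing f with
  | zero => exact h _
  | succ N ih => exact ⟨⟨trivial, ih fun _ => h _⟩, trivial, ih h⟩

section FixForm

variable (χ : A → Set ℕ → ML1 F A) (N : ℕ) (E : ℕ → Prop) (rk : A → ℕ)

/-- The formula for the state `a` in the system of nested fixpoint equations for the states of
rank below `n`, in terms of formulas `θ` for the remaining states. -/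
noncomputable def fixForm : ℕ → A → (A → MuForm F) → MuForm F
  | 0, a, θ => colorCase N fun c => (χ a c).subst θ
  | n + 1, a, θ =>
    if h : ∃ b, rk b = n then
      fixForm n a (Function.update θ h.choose
        ((if E n then MuForm.nu else MuForm.mu) (N + n)
          (fixForm n h.choose (Function.update θ h.choose (.var (N + n))))))
    else fixForm n a θ

variable {χ N E rk}

theorem posIn_fixForm {p n : ℕ} (hp : N ≤ p) {a : A} {θ : A → MuForm F}
    (h : ∀ b, (θ b).PosIn p) : (fixForm χ N E rk n a θ).PosIn p := by
  induction n generalizing a θ with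
  | zero => exact posIn_colorCase hp fun c => ML1.posIn_subst h _
  | succ n ih =>
    have hupd : ∀ (b : A) (ψ : MuForm F), ψ.PosIn p → ∀ b', (Function.update θ b ψ b').PosIn p := by
      intro b ψ hψ b'
      rcases eq_or_ne b' b with rfl | hb
      · simpa
      · simpa [hb] using h b'
    simp only [fixForm]
    split_ifs with hb hE
    · exact ih (hupd _ _ (.inr (ih (hupd _ _ trivial))))
    · exact ih (hupd _ _ (.inr (ih (hupd _ _ trivial))))
    · exact ih h

theorem wf_fixForm {n : ℕ} {a : A} {θ : A → MuForm F} (h : ∀ b, (θ b).WF)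
    (h' : ∀ b p, N ≤ p → (θ b).PosIn p) : (fixForm χ N E rk n a θ).WF := by
  induction n generalizing a θ with
  | zero => exact wf_colorCase _ fun c => ML1.wf_subst h _
  | succ n ih =>
    have hupd : ∀ (b : A) (ψ : MuForm F), ψ.WF → (∀ p, N ≤ p → ψ.PosIn p) →
        (∀ b', (Function.update θ b ψ b').WF) ∧
        ∀ b' p, N ≤ p → (Function.update θ b ψ b').PosIn p := by
      refine fun b ψ hψ hψ' => ⟨fun b' => ?_, fun b' p hp => ?_⟩
      all_goals rcases eq_or_ne b' b with rfl | hb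
      · simpa
      · simpa [hb] using h b'
      · simpa using hψ' p hp
      · simpa [hb] using h' b' p hp
    have hvar := fun b => hupd b (.var (N + n)) trivial fun _ _ => trivial
    simp only [fixForm]
    split_ifs with hb hE
    · obtain ⟨h1, h2⟩ := hupd hb.choose (.nu (N + n)
        (fixForm χ N E rk n hb.choose (Function.update θ hb.choose (.var (N + n)))))
        ⟨posIn_fixForm (by omega) fun b => (hvar _).2 b _ (by omega), ih (hvar _).1 (hvar _).2⟩
        fun p hp => .inr (posIn_fixForm hp fun b => (hvar _).2 b p hp)
      exact ih h1 h2
    · obtain ⟨h1, h2⟩ := hupd hb.choose (.mu (N + n)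
        (fixForm χ N E rk n hb.choose (Function.update θ hb.choose (.var (N + n)))))
        ⟨posIn_fixForm (by omega) fun b => (hvar _).2 b _ (by omega), ih (hvar _).1 (hvar _).2⟩
        fun p hp => .inr (posIn_fixForm hp fun b => (hvar _).2 b p hp)
      exact ih h1 h2
    · exact ih h h'

/-- The solution of the system of nested fixpoint equations for the states of rank below `n`, in
terms of the values `W` of the remaining states. -/
def partialFix (E : ℕ → Prop) (rk : A → ℕ) (G : Set (A × S) → Set (A × S)) (n : ℕ)
    (W : A → Set S) : Set (A × S) :=
  nestedFix E (fun p => rk p.1) n fun Y => G {p | if rk p.1 < n then p ∈ Y else p.2 ∈ W p.1}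

variable {G : Set (A × S) → Set (A × S)}

theorem partialFix_mono (hG : Monotone G) {n : ℕ} : Monotone (partialFix E rk G n) := by
  refine fun W W' hW => nestedFix_mono n fun Y => hG fun p hp => ?_
  simp only [Set.mem_ofPred_eq] at hp ⊢
  split_ifs with h
  · simpa [h] using hp
  · exact hW _ (by simpa [h] using hp)

theorem partialFix_succ_of_forall_ne {n : ℕ} (h : ∀ b, rk b ≠ n) (W : A → Set S) :
    partialFix E rk G (n + 1) W = partialFix E rk G n W := by
  have : ∀ Z : Set (A × S), (nestedFix E (fun p => rk p.1) n fun Y =>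
      G {p | if rk p.1 < n + 1 then p ∈ Y ∩ {p | rk p.1 < n} ∪ Z ∩ {p | rk p.1 = n}
        else p.2 ∈ W p.1}) = partialFix E rk G n W := by
    intro Z
    unfold partialFix
    congr! 3 with Y
    ext p
    have hp := h p.1
    by_cases h1 : rk p.1 < n
    · simp [h1, h1.le, h]
    · simp [h1, show ¬ rk p.1 ≤ n by omega]
  rw [partialFix]
  simp only [nestedFix, this]
  split_ifs
  · exact subset_antisymm (Set.sUnion_subset fun Z h => h)
      (Set.subset_sUnion_of_mem (Set.Subset.refl _))
  · exact subset_antisymm (Set.sInter_subset_of_mem (Set.Subset.refl _))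
      (Set.subset_sInter fun Z h => h)

/-- The greatest or least fixpoint of a monotone operator on sets. -/
def fixOf {X : Type} (b : Prop) (K : Set X → Set X) : Set X :=
  if b then ⋃₀ {z | z ⊆ K z} else ⋂₀ {z | K z ⊆ z}

theorem partialFix_succ (hG : Monotone G) (hrk : Function.Injective rk) (b : A) (W : A → Set S) :
    partialFix E rk G (rk b + 1) W = partialFix E rk G (rk b) (Function.update W b
      (fixOf (E (rk b)) fun z =>
        {s | (b, s) ∈ partialFix E rk G (rk b) (Function.update W b z)})) := by
  set K : Set S →o Set (A × S) := ⟨fun z => partialFix E rk G (rk b) (Function.update W b z),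
    fun z z' hz => partialFix_mono hG fun c => by
      rcases eq_or_ne c b with rfl | hc
      · simpa
      · simp [hc]⟩ with hK
  set π : Set (A × S) →o Set S := ⟨fun Z => {s | (b, s) ∈ Z}, fun Z Z' hZ s hs => hZ hs⟩
  have key : ∀ Z : Set (A × S), (nestedFix E (fun p => rk p.1) (rk b) fun Y =>
      G {p | if rk p.1 < rk b + 1 then p ∈ Y ∩ {p | rk p.1 < rk b} ∪ Z ∩ {p | rk p.1 = rk b}
        else p.2 ∈ W p.1}) = K (π Z) := by
    intro Z
    change _ = partialFix E rk G (rk b) _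
    unfold partialFix
    congr! 3 with Y
    ext ⟨c, s⟩
    rcases lt_trichotomy (rk c) (rk b) with h | h | h
    · simp [h, h.le, h.ne]
    · obtain rfl := hrk h
      simp
      rfl
    · have hc : c ≠ b := by
        rintro rfl
        exact lt_irrefl _ h
      simp [h.not_gt, hc, h.not_ge]
  rw [partialFix]
  simp only [nestedFix, key]
  change _ = K _
  unfold fixOf
  split_ifs
  · exact (K.map_gfp_comp π).symm
  · exact (K.map_lfp_comp π).symm

theorem sem_fixForm (hrk : Function.Injective rk) (σ : S → T.obj S)
    (hG : ∀ V, Monotone (modalOp χ N σ V)) {n : ℕ} {a : A} {θ : A → MuForm F}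
    (hθ : ∀ b (V V' : ℕ → Set S), (∀ p, ¬ (N ≤ p ∧ p < N + n) → V p = V' p) →
      (θ b).sem σ V = (θ b).sem σ V') (V : ℕ → Set S) :
    (fixForm χ N E rk n a θ).sem σ V =
      {s | (a, s) ∈ partialFix E rk (modalOp χ N σ V) n fun b => (θ b).sem σ V} := by
  induction n generalizing a θ V with
  | zero =>
    ext s
    simp only [fixForm, mem_sem_colorCase, ML1.mem_sem_subst]
    simp [partialFix, nestedFix, modalOp]
  | succ n ih =>
    have hθn : ∀ b (V V' : ℕ → Set S), (∀ p, ¬ (N ≤ p ∧ p < N + n) → V p = V' p) →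
        (θ b).sem σ V = (θ b).sem σ V' := fun b V V' h =>
      hθ b V V' fun p hp => h p fun h' => hp ⟨h'.1, by omega⟩
    have hop : ∀ V V' : ℕ → Set S, (∀ p, p < N → V p = V' p) →
        modalOp χ N σ V = modalOp χ N σ V' := by
      intro V V' h
      funext Y
      ext p
      have : {q | q < N ∧ p.2 ∈ V q} = {q | q < N ∧ p.2 ∈ V' q} := by
        ext q
        exact and_congr_right fun hq => by rw [h q hq]
      simp only [modalOp, Set.mem_ofPred_eq, this]
    simp only [fixForm]
    by_cases hb : ∃ b, rk b = n
    · rw [dif_pos hb]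
      obtain ⟨b, rfl⟩ := id hb
      have hbc : hb.choose = b := hrk hb.choose_spec
      rw [hbc]
      set τ := (if E (rk b) then MuForm.nu else MuForm.mu) (N + rk b)
        (fixForm χ N E rk (rk b) b (Function.update θ b (.var (N + rk b)))) with hτ
      have hvar : ∀ V : ℕ → Set S,
          (fixForm χ N E rk (rk b) b (Function.update θ b (.var (N + rk b)))).sem σ V =
          {s | (b, s) ∈ partialFix E rk (modalOp χ N σ V) (rk b)
            (Function.update (fun c => (θ c).sem σ V) b (V (N + rk b)))} := by
        intro V
        rw [ih]
        · congr! 4 with s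
          funext c
          rcases eq_or_ne c b with rfl | hc
          · simp [MuForm.sem]
          · simp [hc]
        · intro c V V' h
          rcases eq_or_ne c b with rfl | hc
          · simpa [MuForm.sem] using h (N + rk c) (by omega)
          · simpa [hc] using hθn c V V' h
      have hτs : ∀ V, τ.sem σ V = fixOf (E (rk b)) fun z =>
          {s | (b, s) ∈ partialFix E rk (modalOp χ N σ V) (rk b)
            (Function.update (fun c => (θ c).sem σ V) b z)} := by
        intro V
        have h1 : ∀ z, (fixForm χ N E rk (rk b) b
            (Function.update θ b (.var (N + rk b)))).sem σ (updW V (N + rk b) z) =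
            {s | (b, s) ∈ partialFix E rk (modalOp χ N σ V) (rk b)
            (Function.update (fun c => (θ c).sem σ V) b z)} := by
          intro z
          rw [hvar, hop (updW V (N + rk b) z) V fun p hp => if_neg (by omega)]
          congr! 5 with s
          · refine funext fun c => hθ c _ _ fun p hp => ?_
            have : p ≠ N + rk b := by omega
            simp [updW, this]
          · exact if_pos rfl
        rw [hτ, fixOf]
        split_ifs <;> simp only [MuForm.sem, h1]
      rw [ih, partialFix_succ (hG V) hrk]
      · congr! 4 with s
        funext c
        rcases eq_or_ne c b with rfl | hc
        · simpa using hτs V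
        · simp [hc]
      · intro c V V' h
        rcases eq_or_ne c b with rfl | hc
        · simp only [Function.update_self, hτs]
          rw [hop V V' fun p hp => h p fun h' => by omega]
          congr! 7 with z
          funext c'
          exact hθn c' V V' h
        · simpa [hc] using hθn c V V' h
    · rw [dif_neg hb, ih hθn, partialFix_succ_of_forall_ne fun b h => hb ⟨b, h⟩]

end FixForm

theorem LatTerm.sem_mono {X : Type} (t : LatTerm A) {V V' : A → Set X} (h : ∀ a, V a ⊆ V' a) :
    t.sem V ⊆ t.sem V' := by
  induction t with
  | var a => exact h a
  | and s t ihs iht => exact Set.inter_subset_inter ihs iht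
  | or s t ihs iht => exact Set.union_subset_union ihs iht

theorem ML1.sat_mono {X : Type} {α : T.obj X} (φ : ML1 F A) {V V' : A → Set X}
    (h : ∀ a, V a ⊆ V' a) : φ.sat X α V → φ.sat X α V' := by
  induction φ with
  | bot => exact id
  | top => exact id
  | lift i ψ => exact fun h' => F.mono i _ _ _ (fun k => (ψ k).sem_mono h) h'
  | or φ ψ ihφ ihψ => exact Or.imp ihφ ihψ
  | and φ ψ ihφ ihψ => exact And.imp ihφ ihψ

theorem modalOp_mono (χ : A → Set ℕ → ML1 F A) (N : ℕ) (σ : S → T.obj S) (V : ℕ → Set S) :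
    Monotone (modalOp χ N σ V) :=
  fun _ _ h _ hp => ML1.sat_mono _ (fun _ _ hs => h hs) hp

/-- Modal automata are equivalent to formulas of the `μ`-calculus. -/
theorem exists_muForm_of_modal [Finite A] (χ : A → Set ℕ → ML1 F A) (N : ℕ) (E : ℕ → Prop)
    (Ω : A → ℕ) (a : A) :
    ∃ ψ : MuForm F, ψ.WF ∧ ∀ (S : Type) (σ : S → T.obj S) (V : ℕ → Set S) (s : S),
      (a, s) ∈ Win E (fun p => Ω p.1) (modalOp χ N σ V) ↔ s ∈ ψ.sem σ V := by
  obtain ⟨m, ⟨e⟩⟩ := Finite.exists_equiv_fin A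
  have hm : 0 < m := (e a).pos
  set rk : A → ℕ := fun b => Ω b * m + e b with hrk_def
  have hdiv : ∀ b, rk b / m = Ω b := fun b => by
    simp [hrk_def, mul_comm, Nat.mul_add_div hm]
  have hrk : Function.Injective rk := fun b c h => by
    have h1 : Ω b = Ω c := by rw [← hdiv, ← hdiv, h]
    simp only [hrk_def, h1, Nat.add_left_cancel_iff] at h
    exact e.injective (Fin.ext h)
  obtain ⟨n, hn⟩ := (Set.finite_range rk).bddAbove
  have hn' : ∀ b, rk b < n + 1 := fun b => Nat.lt_succ_of_le (hn ⟨b, rfl⟩)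
  refine ⟨fixForm χ N (fun k => E (k / m)) rk (n + 1) a fun _ => .bot,
    wf_fixForm (fun _ => trivial) fun _ _ _ => trivial, fun S σ V s => ?_⟩
  rw [sem_fixForm hrk σ (modalOp_mono χ N σ) fun _ _ _ _ => rfl]
  have hpar : ∀ x : ℕ → A × S, LimsupIn E (fun i => Ω (x i).1) ↔
      LimsupIn (fun k => E (k / m)) (fun i => rk (x i).1) := by
    intro x
    rw [limsupIn_comp (f := fun k => k / m) (fun _ _ h => Nat.div_le_div_right h)
      fun i => (hn' (x i).1).le]
    simp only [hdiv]
  rw [win_congr_parity (Ω' := fun p : A × S => rk p.1) hpar,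
    win_eq_nestedFix (Ω := fun p : A × S => rk p.1) (fun p => hn' p.1) (modalOp_mono χ N σ V)]
  simp [partialFix, hn']

/-- Every bisimulation invariant formula of coalgebraic monadic second-order logic is equivalent
to a formula of the coalgebraic `μ`-calculus. -/
theorem BisimInv.exists_muForm (hec : ExpressivelyComplete F)
    (had : AdmitsAdequateUniformConstruction T) {φ : MSOForm F} (hφ : BisimInv φ) :
    ∃ ψ : MuForm F, ψ.WF ∧ ∀ (M : TModel T) (u : M.S), φ.sat M.σ M.V u ↔ u ∈ ψ.sem M.σ M.V := by
  obtain ⟨𝔸, h𝔸⟩ := Aut.exists_recognizes φ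
  obtain ⟨U, χ, hχ⟩ := 𝔸.exists_modal hec had
  obtain ⟨ψ, hψ, hψs⟩ := exists_muForm_of_modal χ 𝔸.bound 𝔸.E 𝔸.Ω 𝔸.start
  refine ⟨ψ, hψ, fun M u => (hφ.sat_iff_mem_win h𝔸 U M u).trans ?_⟩
  rw [← hψs, ← hχ]
  rfl

end GameToFormula

section Invariance

variable {T : SetFunctor} {F : LiftingFamily T}

theorem MuForm.sem_mono {S : Type} (σ : S → T.obj S) (ψ : MuForm F) {V V' : ℕ → Set S}
    (h : ∀ q, V q ⊆ V' q) (h' : ∀ q, V q ≠ V' q → ψ.PosIn q) : ψ.sem σ V ⊆ ψ.sem σ V' := by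
  have hupd : ∀ {φ : MuForm F} {p : ℕ} {V V' : ℕ → Set S} (Z : Set S), (∀ q, V q ⊆ V' q) →
      (∀ q, V q ≠ V' q → p = q ∨ φ.PosIn q) →
      (∀ q, updW V p Z q ⊆ updW V' p Z q) ∧ ∀ q, updW V p Z q ≠ updW V' p Z q → φ.PosIn q := by
    intro φ p V V' Z h h'
    refine ⟨fun q => ?_, fun q hq => ?_⟩
    all_goals by_cases hqp : q = p
    · simp [updW, hqp]
    · simpa [updW, hqp] using h q
    · simp [updW, hqp] at hq
    · exact (h' q (by simpa [updW, hqp] using hq)).resolve_left (Ne.symm hqp)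
  induction ψ generalizing V V' with
  | var p => exact h p
  | nvar p =>
    by_cases hp : V p = V' p
    · simp [sem, hp]
    · exact absurd rfl (h' p hp)
  | bot => exact subset_rfl
  | top => exact subset_rfl
  | lift i arg ih =>
    exact fun s hs => F.mono i _ _ _ (fun k => ih k h fun q hq => h' q hq k) hs
  | or φ ψ ihφ ihψ =>
    exact Set.union_subset_union (ihφ h fun q hq => (h' q hq).1) (ihψ h fun q hq => (h' q hq).2)
  | and φ ψ ihφ ihψ =>
    exact Set.inter_subset_inter (ihφ h fun q hq => (h' q hq).1) (ihψ h fun q hq => (h' q hq).2)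
  | mu p φ ih =>
    refine Set.sInter_subset_sInter fun Z hZ => ?_
    exact Set.Subset.trans (ih (hupd Z h h').1 (hupd Z h h').2) hZ
  | nu p φ ih =>
    refine Set.sUnion_subset_sUnion fun Z hZ => ?_
    exact Set.Subset.trans hZ (ih (hupd Z h h').1 (hupd Z h h').2)

theorem MuForm.sem_updW_mono {S : Type} (σ : S → T.obj S) {ψ : MuForm F} {p : ℕ}
    (hψ : ψ.PosIn p) (V : ℕ → Set S) {Z Z' : Set S} (h : Z ⊆ Z') :
    ψ.sem σ (updW V p Z) ⊆ ψ.sem σ (updW V p Z') := by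
  refine ψ.sem_mono σ (fun q => ?_) fun q hq => ?_
  all_goals by_cases hqp : q = p
  · simpa [updW, hqp] using h
  · simp [updW, hqp]
  · exact hqp ▸ hψ
  · simp [updW, hqp] at hq

theorem preimage_updW {S S' : Type} (f : S → S') (V : ℕ → Set S') (p : ℕ) (Z : Set S') :
    (fun q => f ⁻¹' updW V p Z q) = updW (fun q => f ⁻¹' V q) p (f ⁻¹' Z) := by
  funext q
  by_cases h : q = p <;> simp [updW, h]

theorem MuForm.sem_preimage {S S' : Type} {σ : S → T.obj S} {σ' : S' → T.obj S'} {f : S → S'}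
    (hf : ∀ x, σ' (f x) = T.map f (σ x)) {ψ : MuForm F} (hψ : ψ.WF) (V : ℕ → Set S') :
    ψ.sem σ (fun q => f ⁻¹' V q) = f ⁻¹' ψ.sem σ' V := by
  induction ψ generalizing V with
  | var p => rfl
  | nvar p => rfl
  | bot => rfl
  | top => rfl
  | lift i arg ih =>
    ext s
    simp only [sem, fun k => ih k (hψ k) V, PredLifting.natural, Set.mem_ofPred_eq,
      Set.mem_preimage, hf]
  | or φ ψ ihφ ihψ => simp only [sem, ihφ hψ.1, ihψ hψ.2, Set.preimage_union]
  | and φ ψ ihφ ihψ => simp only [sem, ihφ hψ.1, ihψ hψ.2, Set.preimage_inter]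
  | mu p φ ih =>
    apply subset_antisymm
    · intro x hx Z hZ
      refine hx (f ⁻¹' Z) ?_
      change φ.sem σ _ ⊆ _
      rw [← preimage_updW, ih hψ.2]
      exact Set.preimage_mono hZ
    · intro x hx Z hZ
      refine hx {y | ∀ x', f x' = y → x' ∈ Z} (fun y hy x' hx' => hZ ?_) x rfl
      subst hx'
      change x' ∈ f ⁻¹' _ at hy
      rw [← ih hψ.2, preimage_updW] at hy
      have hsub : f ⁻¹' {y | ∀ x', f x' = y → x' ∈ Z} ⊆ Z := fun x'' hx'' => hx'' x'' rfl
      exact sem_updW_mono σ hψ.1 _ hsub hy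
  | nu p φ ih =>
    apply subset_antisymm
    · rintro x ⟨Z, hZ, hx⟩
      refine ⟨f '' Z, Set.image_subset_iff.2 ?_, x, hx, rfl⟩
      rw [← ih hψ.2, preimage_updW]
      exact Set.Subset.trans hZ (sem_updW_mono σ hψ.1 _ (Set.subset_preimage_image f Z))
    · rintro x ⟨Z, hZ, hx⟩
      refine ⟨f ⁻¹' Z, ?_, hx⟩
      change _ ⊆ φ.sem σ _
      rw [← preimage_updW, ih hψ.2]
      exact Set.preimage_mono hZ

theorem MuForm.mem_sem_iff_of_behEq {ψ : MuForm F} (hψ : ψ.WF) {M M' : TModel T} {s : M.S}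
    {s' : M'.S} (h : BehEq M s M' s') : s ∈ ψ.sem M.σ M.V ↔ s' ∈ ψ.sem M'.σ M'.V := by
  obtain ⟨N, f, g, hf, hg, hfg⟩ := h
  have key : ∀ (M : TModel T) (f : M.S → N.S) (s : M.S), IsHom M N f →
      (s ∈ ψ.sem M.σ M.V ↔ f s ∈ ψ.sem N.σ N.V) := by
    intro M f s hf
    have hV : M.V = fun q => f ⁻¹' N.V q := funext fun q => Set.ext (hf.1 q)
    rw [hV, sem_preimage hf.2 hψ]
    rfl
  rw [key M f s hf, key M' g s' hg, hfg]

end Invariance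

/-- Definability in coalgebraic monadic second-order logic over an arbitrary type of variables. -/
def MSODef {T : SetFunctor} (F : LiftingFamily T) (W : Type)
    (G : ∀ S : Type, (S → T.obj S) → (W → Set S) → S → Prop) : Prop :=
  (∃ K : Set W, K.Finite ∧ ∀ S σ V V' u, (∀ w ∈ K, V w = V' w) → (G S σ V u ↔ G S σ V' u)) ∧
  ∀ ρ : W → ℕ, ∃ φ : MSOForm F, ∀ S σ V u, φ.sat σ V u ↔ G S σ (V ∘ ρ) u

namespace MSODef

variable {T : SetFunctor} {F : LiftingFamily T} {W W' : Type}
  {G H : ∀ S : Type, (S → T.obj S) → (W → Set S) → S → Prop}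

theorem congr (h : MSODef F W G) (hGH : ∀ S σ V u, G S σ V u ↔ H S σ V u) : MSODef F W H := by
  obtain rfl : G = H := by
    funext S σ V u
    exact propext (hGH ..)
  exact h

theorem rename (h : MSODef F W G) (f : W → W') :
    MSODef F W' fun S σ V u => G S σ (V ∘ f) u := by
  obtain ⟨⟨K, hK, hG⟩, hφ⟩ := h
  exact ⟨⟨f '' K, hK.image f, fun S σ V V' u h => hG _ _ _ _ _ fun w hw => h _ ⟨w, hw, rfl⟩⟩,
    fun ρ => hφ (ρ ∘ f)⟩

theorem sr (a : W) : MSODef F W fun _ _ V u => V a = {u} :=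
  ⟨⟨{a}, Set.finite_singleton a, fun _ _ _ _ _ h => by beta_reduce; rw [h a rfl]⟩,
    fun ρ => ⟨.sr (ρ a), fun _ _ _ _ => Iff.rfl⟩⟩

theorem subset (a b : W) : MSODef F W fun _ _ V _ => V a ⊆ V b :=
  ⟨⟨{a, b}, Set.toFinite _, fun _ _ _ _ _ h => by
    beta_reduce; rw [h a (.inl rfl), h b (.inr rfl)]⟩,
    fun ρ => ⟨.subset (ρ a) (ρ b), fun _ _ _ _ => Iff.rfl⟩⟩

theorem lift (i : F.ι) (a : W) (b : Fin (F.ar i) → W) :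
    MSODef F W fun S σ V _ => V a ⊆ {s | σ s ∈ (F.lf i).app S fun k => V (b k)} := by
  refine ⟨⟨insert a (Set.range b), (Set.finite_range b).insert a, fun S σ V V' u h => ?_⟩,
    fun ρ => ⟨.lift i (ρ a) (ρ ∘ b), fun _ _ _ _ => Iff.rfl⟩⟩
  simp only [h a (.inl rfl), fun k => h (b k) (.inr ⟨k, rfl⟩)]

theorem neg (h : MSODef F W G) : MSODef F W fun S σ V u => ¬ G S σ V u := by
  obtain ⟨⟨K, hK, hG⟩, hφ⟩ := h
  exact ⟨⟨K, hK, fun S σ V V' u h => not_congr (hG _ _ _ _ _ h)⟩, fun ρ =>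
    (hφ ρ).elim fun φ hφ => ⟨.neg φ, fun S σ V u => not_congr (hφ ..)⟩⟩

theorem or (hG : MSODef F W G) (hH : MSODef F W H) :
    MSODef F W fun S σ V u => G S σ V u ∨ H S σ V u := by
  obtain ⟨⟨K, hK, hG⟩, hφ⟩ := hG
  obtain ⟨⟨L, hL, hH⟩, hψ⟩ := hH
  refine ⟨⟨K ∪ L, hK.union hL, fun S σ V V' u h => or_congr
    (hG _ _ _ _ _ fun w hw => h w (.inl hw)) (hH _ _ _ _ _ fun w hw => h w (.inr hw))⟩,
    fun ρ => ?_⟩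
  obtain ⟨φ, hφ⟩ := hφ ρ
  obtain ⟨ψ, hψ⟩ := hψ ρ
  exact ⟨.or φ ψ, fun S σ V u => or_congr (hφ ..) (hψ ..)⟩

theorem ex {G : ∀ S : Type, (S → T.obj S) → (Option W → Set S) → S → Prop}
    (h : MSODef F (Option W) G) :
    MSODef F W fun S σ V u => ∃ Z : Set S, G S σ (fun w => w.elim Z V) u := by
  obtain ⟨⟨K, hK, hG⟩, hφ⟩ := h
  have hK' : (some ⁻¹' K).Finite := hK.preimage (Option.some_injective W).injOn
  refine ⟨⟨some ⁻¹' K, hK', fun S σ V V' u h => exists_congr fun Z => ?_⟩, fun ρ => ?_⟩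
  · refine hG _ _ _ _ _ fun w hw => ?_
    cases w with
    | none => rfl
    | some w => exact h w hw
  · obtain ⟨n, hn⟩ := (hK'.image ρ).exists_notMem
    obtain ⟨φ, hφ⟩ := hφ fun w => w.elim n ρ
    refine ⟨.ex n φ, fun S σ V u => exists_congr fun Z => (hφ ..).trans ?_⟩
    refine hG _ _ _ _ _ fun w hw => ?_
    cases w with
    | none => simp [updW]
    | some w =>
      have : ρ w ≠ n := fun h => hn ⟨w, hw, h⟩
      simp [updW, this]

theorem and (hG : MSODef F W G) (hH : MSODef F W H) :
    MSODef F W fun S σ V u => G S σ V u ∧ H S σ V u :=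
  (hG.neg.or hH.neg).neg.congr fun _ _ _ _ => by tauto

theorem imp (hG : MSODef F W G) (hH : MSODef F W H) :
    MSODef F W fun S σ V u => G S σ V u → H S σ V u :=
  (hG.neg.or hH).congr fun _ _ _ _ => by tauto

theorem all {G : ∀ S : Type, (S → T.obj S) → (Option W → Set S) → S → Prop}
    (h : MSODef F (Option W) G) :
    MSODef F W fun S σ V u => ∀ Z : Set S, G S σ (fun w => w.elim Z V) u :=
  h.neg.ex.neg.congr fun _ _ _ _ => by push Not; rfl

theorem subset_empty (a : W) : MSODef F W fun _ _ V _ => V a ⊆ ∅ :=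
  (all (subset (some a) none)).congr fun _ _ _ _ =>
    ⟨fun h => h ∅, fun h _ => h.trans (Set.empty_subset _)⟩

theorem subset_univ (a : W) : MSODef F W fun S _ V _ => V a ⊆ (Set.univ : Set S) :=
  (subset a a).congr fun _ _ _ _ => iff_of_true subset_rfl (Set.subset_univ _)

theorem subset_compl (a b : W) : MSODef F W fun _ _ V _ => V a ⊆ (V b)ᶜ :=
  (all (imp (subset none (some a)) (imp (subset none (some b)) (subset_empty none)))).congr
    fun S _ V _ => by
      refine ⟨fun h x hx hx' => ?_, fun h Z hZ hZ' x hx => h (hZ hx) (hZ' hx)⟩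
      exact h {x} (Set.singleton_subset_iff.2 hx) (Set.singleton_subset_iff.2 hx') rfl

theorem forall_fin {n : ℕ} {G : Fin n → ∀ S : Type, (S → T.obj S) → (W → Set S) → S → Prop}
    (h : ∀ k, MSODef F W (G k)) : MSODef F W fun S σ V u => ∀ k, G k S σ V u := by
  induction n with
  | zero =>
    refine ⟨⟨∅, Set.finite_empty, fun _ _ _ _ _ _ => iff_of_true (nofun) (nofun)⟩,
      fun ρ => ⟨.neg .bot, fun _ _ _ _ => iff_of_true id (nofun)⟩⟩
  | succ n ih =>
    exact ((h 0).and (ih fun k => h k.succ)).congr fun S σ V u =>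
      (Fin.forall_fin_succ (P := fun k => G k S σ V u)).symm

theorem exists_fin {n : ℕ} {G : ∀ S : Type, (S → T.obj S) → (W ⊕ Fin n → Set S) → S → Prop}
    (h : MSODef F (W ⊕ Fin n) G) :
    MSODef F W fun S σ V u => ∃ Z : Fin n → Set S, G S σ (Sum.elim V Z) u := by
  induction n generalizing W with
  | zero =>
    refine (h.rename (Sum.elim id (nofun))).congr fun S σ V u => ?_
    have : ∀ Z : Fin 0 → Set S, (V ∘ Sum.elim id nofun : W ⊕ Fin 0 → Set S) = Sum.elim V Z := by
      intro Z
      funext w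
      rcases w with w | w
      exacts [rfl, w.elim0]
    exact ⟨fun h => ⟨nofun, this _ ▸ h⟩, fun ⟨Z, h⟩ => this Z ▸ h⟩
  | succ n ih =>
    refine (ih (h.rename (Sum.elim (fun w => .inl (some w))
      (Fin.cons (.inl none) fun k => .inr k) : _ → Option W ⊕ Fin n))).ex.congr fun S σ V u => ?_
    have : ∀ Z Z', (Sum.elim (fun w : Option W => w.elim Z V) Z' ∘ (Sum.elim
        (fun w => .inl (some w)) (Fin.cons (.inl none) fun k => .inr k) :
          _ → Option W ⊕ Fin n)) = (Sum.elim V (Fin.cons Z Z') : _ → Set S) := by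
      intro Z Z'
      funext w
      rcases w with w | w
      · rfl
      · cases w using Fin.cases <;> rfl
    simp only [this]
    exact ⟨fun ⟨Z, Z', h⟩ => ⟨Fin.cons Z Z', h⟩,
      fun ⟨Z, h⟩ => ⟨Z 0, Fin.tail Z, by rwa [Fin.cons_self_tail]⟩⟩

end MSODef

/-- Definability of a set in coalgebraic monadic second-order logic. -/
def SetDef {T : SetFunctor} (F : LiftingFamily T) (W : Type)
    (X : ∀ S : Type, (S → T.obj S) → (W → Set S) → Set S) : Prop :=
  MSODef F (Option W) fun S σ V _ => V none = X S σ (V ∘ some)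

namespace SetDef

variable {T : SetFunctor} {F : LiftingFamily T} {W : Type}
  {X : ∀ S : Type, (S → T.obj S) → (W → Set S) → Set S}

theorem subset (h : SetDef F W X) :
    MSODef F (Option W) fun S σ V _ => V none ⊆ X S σ (V ∘ some) :=
  ((h.rename fun w => w.elim none fun w => some (some w)).and (.subset (some none) none)).ex.congr
    fun _ _ _ _ => ⟨fun ⟨_, h1, h2⟩ => h2.trans h1.subset, fun h => ⟨_, rfl, h⟩⟩

theorem superset (h : SetDef F W X) :
    MSODef F (Option W) fun S σ V _ => X S σ (V ∘ some) ⊆ V none :=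
  ((h.rename fun w => w.elim none fun w => some (some w)).and (.subset none (some none))).ex.congr
    fun _ _ _ _ => ⟨fun ⟨_, h1, h2⟩ => h1.superset.trans h2, fun h => ⟨_, rfl, h⟩⟩

theorem of_subset (h : MSODef F (Option W) fun S σ V _ => V none ⊆ X S σ (V ∘ some)) :
    SetDef F W X :=
  (h.and (((h.rename fun w => w.elim none fun w => some (some w)).imp
    (.subset none (some none))).all)).congr fun _ _ _ _ =>
      ⟨fun h => subset_antisymm h.1 (h.2 _ subset_rfl), fun h =>
        ⟨h.subset, fun _ hZ => hZ.trans h.superset⟩⟩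

theorem of_superset (h : MSODef F (Option W) fun S σ V _ => X S σ (V ∘ some) ⊆ V none) :
    SetDef F W X :=
  (h.and (((h.rename fun w => w.elim none fun w => some (some w)).imp
    (.subset (some none) none)).all)).congr fun _ _ _ _ =>
      ⟨fun h => subset_antisymm (h.2 _ subset_rfl) h.1, fun h =>
        ⟨h.superset, fun _ hZ => h.subset.trans hZ⟩⟩

end SetDef

theorem MuForm.setDef {T : SetFunctor} {F : LiftingFamily T} (ψ : MuForm F) :
    SetDef F ℕ fun _ σ V => ψ.sem σ V := by
  have hupd : ∀ {S : Type} (V : Option ℕ → Set S) (Z : Set S) (p : ℕ),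
      ((fun w : Option (Option ℕ) => w.elim Z V) ∘
        fun w : Option ℕ => w.elim none fun q => if q = p then none else some (some q)) ∘ some =
      updW (V ∘ some) p Z := by
    intro S V Z p
    funext q
    by_cases h : q = p <;> simp [updW, h]
  induction ψ with
  | var p => exact .of_subset (.subset none (some p))
  | nvar p => exact .of_subset (.subset_compl none (some p))
  | bot => exact .of_subset (.subset_empty none)
  | top => exact .of_subset (.subset_univ none)
  | lift i arg ih =>
    refine .of_subset ((MSODef.exists_fin ((MSODef.forall_fin fun k =>
      (ih k).rename (W' := Option ℕ ⊕ Fin (F.ar i)) fun w =>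
        w.elim (.inr k) fun w => .inl (some w)).and
      (.lift i (.inl none) .inr))).congr fun S σ V u => ?_)
    constructor
    · rintro ⟨Z, h1, h2⟩
      obtain rfl : Z = fun k => (arg k).sem σ (V ∘ some) := funext h1
      exact h2
    · exact fun h => ⟨_, fun k => rfl, h⟩
  | or φ ψ ihφ ihψ =>
    exact .of_superset ((ihφ.superset.and ihψ.superset).congr fun _ _ _ _ =>
      Set.union_subset_iff.symm)
  | and φ ψ ihφ ihψ =>
    exact .of_subset ((ihφ.subset.and ihψ.subset).congr fun _ _ _ _ =>
      Set.subset_inter_iff.symm)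
  | mu p φ ih =>
    refine .of_subset (((ih.superset.rename fun w => w.elim none fun q =>
      if q = p then none else some (some q)).imp (.subset (some none) none)).all.congr
      fun S σ V u => ?_)
    refine Iff.trans (forall_congr' fun Z => ?_) Set.subset_sInter_iff.symm
    rw [hupd]
    rfl
  | nu p φ ih =>
    refine .of_superset (((ih.subset.rename fun w => w.elim none fun q =>
      if q = p then none else some (some q)).imp (.subset none (some none))).all.congr
      fun S σ V u => ?_)
    refine Iff.trans (forall_congr' fun Z => ?_) Set.sUnion_subset_iff.symm
    rw [hupd]
    rfl

/-- Every formula of the coalgebraic `μ`-calculus is equivalent to a formula of coalgebraic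
monadic second-order logic. -/
theorem MuForm.exists_msoForm {T : SetFunctor} {F : LiftingFamily T} (ψ : MuForm F) :
    ∃ φ : MSOForm F, ∀ (S : Type) (σ : S → T.obj S) (V : ℕ → Set S) (u : S),
      φ.sat σ V u ↔ u ∈ ψ.sem σ V := by
  obtain ⟨φ, hφ⟩ := ((MSODef.sr none).and ψ.setDef.subset).ex.2 id
  refine ⟨φ, fun S σ V u => (hφ S σ V u).trans ⟨?_, fun h => ⟨{u}, rfl, ?_⟩⟩⟩
  · rintro ⟨Z, h1, h2⟩
    exact h2 (h1.symm ▸ rfl)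
  · exact Set.singleton_subset_iff.2 h

/-- **Coalgebraic Bisimulation Invariance.** Let `Λ` be an expressively
complete set of monotone predicate liftings for `T`. If `T` admits an adequate uniform
construction, then `μML_Λ ≡ MSO_Λ/≃`: every `μML_Λ`-formula is equivalent to a
bisimulation-invariant `MSO_Λ`-formula, and every bisimulation-invariant
`MSO_Λ`-formula is equivalent to a `μML_Λ`-formula. -/
theorem coalgebraic_bisimulation_invariance (T : SetFunctor) (F : LiftingFamily T)
    (hec : ExpressivelyComplete F) (had : AdmitsAdequateUniformConstruction T) :
    (∀ ψ : MuForm F, ψ.WF →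
       ∃ φ : MSOForm F, BisimInv φ ∧
         ∀ (M : TModel T) (u : M.S), u ∈ ψ.sem M.σ M.V ↔ φ.sat M.σ M.V u) ∧
    (∀ φ : MSOForm F, BisimInv φ →
       ∃ ψ : MuForm F, ψ.WF ∧
         ∀ (M : TModel T) (u : M.S), φ.sat M.σ M.V u ↔ u ∈ ψ.sem M.σ M.V) := by
  refine ⟨fun ψ hψ => ?_, fun φ hφ => hφ.exists_muForm hec had⟩
  obtain ⟨φ, hφ⟩ := ψ.exists_msoForm
  exact ⟨φ, fun M s M' s' h => (hφ ..).trans ((MuForm.mem_sem_iff_of_behEq hψ h).trans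
    (hφ ..).symm), fun M u => (hφ ..).symm⟩
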